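/- arXiv:1807.04523 — 3 statements merged into one kernel-verified Lean document; each statement's English description precedes it below -/
import Mathlib

section
/- Let S_1,…,S_m (m ≥ 2) be contracting similitudes of ℝ^w with ratios c_i ∈ (0,1), let K ⊆ ℝ^w be compact with S_i(K) ⊆ K for all i and S_i(K) ∩ S_j(K) = ∅ for i ≠ j, let Λ be the self-similar attractor with coding map π : Σ → Λ, and let f : ℝ^w → ℝ^w be a map with f(Λ) = Λ such that π is a homeomorphism onto Λ and f ∘ π = π ∘ σ on Σ. Then the Li-Yorke pairs of f in Λ have full Hausdorff dimension: dim_H LY_f(Λ) = dim_H(Λ × Λ) = 2 · dim_H Λ. -/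
open Filter Set

noncomputable section

/-- The shift map on one-sided sequences over `Fin m`. -/
def shiftMap {m : ℕ} (s : ℕ → Fin m) : ℕ → Fin m := fun k => s (k + 1)

/-- The composition `S_{s_1} ∘ ⋯ ∘ S_{s_{n+1}}` of the maps along the first `n + 1`
digits of the sequence `s` (with `0`-based indexing). -/
def iterComp {m : ℕ} {E : Type*} (S : Fin m → E → E) (s : ℕ → Fin m) : ℕ → E → E
  | 0 => S (s 0)
  | n + 1 => iterComp S s n ∘ S (s (n + 1))

/-- The set of Li-Yorke pairs of a map `f` inside an invariant set `Λ`. -/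
def liYorkePairs {E : Type*} [PseudoMetricSpace E] (f : E → E) (Λ : Set E) :
    Set (E × E) :=
  {p | p.1 ∈ Λ ∧ p.2 ∈ Λ ∧
    liminf (fun n : ℕ => dist (f^[n] p.1) (f^[n] p.2)) atTop = 0 ∧
    0 < limsup (fun n : ℕ => dist (f^[n] p.1) (f^[n] p.2)) atTop}

open MeasureTheory Metric
open scoped NNReal ENNReal Topology

/-- A measure is upper `d`-regular if it gives sets of diameter at most `r` mass at most a constant
multiple of `r ^ d`. -/
def UpperRegular {X : Type*} [PseudoMetricSpace X] [MeasurableSpace X]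
    (ν : Measure X) (d : ℝ) : Prop :=
  ∃ C : ℝ≥0, ∀ (A : Set X) (r : ℝ≥0), 0 < r → ediam A ≤ r → ν A ≤ C * (r : ℝ≥0∞) ^ d

/-- A measure is lower `d`-regular on `Λ` if it gives small balls of radius `r` centered in `Λ`
mass at least a positive constant multiple of `r ^ d`. -/
def LowerRegular {X : Type*} [PseudoMetricSpace X] [MeasurableSpace X]
    (ν : Measure X) (d : ℝ) (Λ : Set X) : Prop :=
  ∃ a : ℝ≥0, 0 < a ∧ ∀ x ∈ Λ, ∀ r : ℝ≥0, 0 < r → r ≤ 1 →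
    a * (r : ℝ≥0∞) ^ d ≤ ν (closedBall x r)

section Regular

variable {X Y : Type*} [MetricSpace X] [MeasurableSpace X] [MetricSpace Y] [MeasurableSpace Y]

theorem UpperRegular.prod {ν : Measure X} {ν' : Measure Y} [SFinite ν'] {d d' : ℝ}
    (hd : 0 ≤ d) (hd' : 0 ≤ d')
    (h : UpperRegular ν d) (h' : UpperRegular ν' d') : UpperRegular (ν.prod ν') (d + d') := by
  obtain ⟨C, hC⟩ := h
  obtain ⟨C', hC'⟩ := h'
  refine ⟨C * C', fun A r hr hA => ?_⟩
  have h1 : ediam (Prod.fst '' A) ≤ r := by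
    simpa using (LipschitzWith.prod_fst.ediam_image_le A).trans (by simpa using hA)
  have h2 : ediam (Prod.snd '' A) ≤ r := by
    simpa using (LipschitzWith.prod_snd.ediam_image_le A).trans (by simpa using hA)
  calc ν.prod ν' A ≤ ν.prod ν' ((Prod.fst '' A) ×ˢ (Prod.snd '' A)) :=
        measure_mono subset_fst_image_prod_snd_image
    _ ≤ ν (Prod.fst '' A) * ν' (Prod.snd '' A) := Measure.prod_prod_le _ _
    _ ≤ (C * (r : ℝ≥0∞) ^ d) * (C' * (r : ℝ≥0∞) ^ d') :=
        mul_le_mul' (hC _ r hr h1) (hC' _ r hr h2)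
    _ = _ := by
        rw [ENNReal.rpow_add_of_nonneg _ _ hd hd']; push_cast; ring

theorem LowerRegular.prod {ν : Measure X} {ν' : Measure Y} [SFinite ν'] {d d' : ℝ}
    (hd : 0 ≤ d) (hd' : 0 ≤ d') {Λ : Set X} {Λ' : Set Y}
    (h : LowerRegular ν d Λ) (h' : LowerRegular ν' d' Λ') :
    LowerRegular (ν.prod ν') (d + d') (Λ ×ˢ Λ') := by
  obtain ⟨a, ha, hball⟩ := h
  obtain ⟨a', ha', hball'⟩ := h'
  refine ⟨a * a', mul_pos ha ha', fun x hx r hr hr1 => ?_⟩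
  calc ((a * a' : ℝ≥0) : ℝ≥0∞) * (r : ℝ≥0∞) ^ (d + d')
      = (a * (r : ℝ≥0∞) ^ d) * (a' * (r : ℝ≥0∞) ^ d') := by
        rw [ENNReal.rpow_add_of_nonneg _ _ hd hd']; push_cast; ring
    _ ≤ ν (closedBall x.1 r) * ν' (closedBall x.2 r) :=
        mul_le_mul' (hball _ hx.1 r hr hr1) (hball' _ hx.2 r hr hr1)
    _ = ν.prod ν' (closedBall x.1 r ×ˢ closedBall x.2 r) := (Measure.prod_prod _ _).symm
    _ = _ := by rw [closedBall_prod_same]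

variable [BorelSpace X]

theorem UpperRegular.le_dimH {ν : Measure X} {d : ℝ≥0} (h : UpperRegular ν d) {A : Set X}
    (hA : ν A ≠ 0) : (d : ℝ≥0∞) ≤ dimH A := by
  obtain ⟨C, hC⟩ := h
  have key : ∀ B : Set X, ediam B ≤ 1 → ν B ≤ C * ediam B ^ (d : ℝ) := by
    intro B hB
    have hfin : ediam B ≠ ∞ := ne_top_of_le_ne_top ENNReal.one_ne_top hB
    lift ediam B to ℝ≥0 using hfin with b hb
    have hlim : Tendsto (fun n : ℕ => ((b + 1 / ((n : ℝ≥0) + 1) : ℝ≥0) : ℝ≥0∞)) atTop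
        (𝓝 (b : ℝ≥0∞)) := by
      rw [ENNReal.tendsto_coe]
      simpa using (tendsto_const_nhds (x := b)).add
        (tendsto_one_div_add_atTop_nhds_zero_nat (𝕜 := ℝ≥0))
    have hlim' := ENNReal.Tendsto.const_mul (a := (C : ℝ≥0∞))
      ((ENNReal.continuous_rpow_const (y := (d : ℝ))).continuousAt.tendsto.comp hlim)
      (Or.inr ENNReal.coe_ne_top)
    refine ge_of_tendsto' hlim' fun n => ?_
    refine hC B _ (by positivity) ?_
    rw [← hb]
    exact_mod_cast le_self_add
  have hle : ((C + 1 : ℝ≥0) : ℝ≥0∞)⁻¹ • ν ≤ μH[d] := by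
    refine Measure.le_hausdorffMeasure _ _ 1 one_pos fun B hB => ?_
    rw [Measure.smul_apply, smul_eq_mul, mul_comm, ← div_eq_mul_inv]
    refine ENNReal.div_le_of_le_mul' ((key B hB).trans ?_)
    gcongr
    simp
  refine le_dimH_of_hausdorffMeasure_ne_zero fun h0 => hA ?_
  have := (hle A).trans h0.le
  rw [Measure.smul_apply, smul_eq_mul, nonpos_iff_eq_zero, mul_eq_zero] at this
  exact this.resolve_left (ENNReal.inv_ne_zero.2 ENNReal.coe_ne_top)

theorem LowerRegular.dimH_le {ν : Measure X} [IsFiniteMeasure ν] {d : ℝ≥0} {Λ : Set X}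
    (h : LowerRegular ν d Λ) : dimH Λ ≤ d := by
  obtain ⟨a, ha, hball⟩ := h
  set r : ℕ → ℝ≥0 := fun n => 1 / ((n : ℝ≥0) + 1) with hr
  have hr0 : ∀ n, 0 < r n := fun n => by positivity
  have hr1 : ∀ n, r n ≤ 1 := fun n => by
    rw [hr]; exact div_le_self zero_le_one (by simp)
  have hcover := fun n => Vitali.exists_disjoint_subfamily_covering_enlargement_closedBall Λ
    (id : X → X) (fun _ => (r n : ℝ)) (r n) (fun _ _ => le_rfl) 5 (by norm_num)
  choose u hu hdis hcov using hcover
  have hpos : ∀ n, ∀ x ∈ Λ, 0 < ν (closedBall x (r n)) := fun n x hx =>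
    lt_of_lt_of_le (ENNReal.mul_pos (by exact_mod_cast ha.ne')
      (ENNReal.rpow_pos (by exact_mod_cast hr0 n) ENNReal.coe_ne_top).ne')
      (hball x hx (r n) (hr0 n) (hr1 n))
  have hdis' : ∀ n, Pairwise (Function.onFun Disjoint
      fun x : u n => closedBall (x : X) (r n)) := fun n x y hxy =>
    hdis n x.2 y.2 (fun h => hxy (Subtype.ext h))
  have hcount : ∀ n, Countable (u n) := fun n => by
    have := Measure.countable_meas_pos_of_disjoint_iUnion (μ := ν)
      (fun x : u n => isClosed_closedBall.measurableSet) (hdis' n)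
    have huniv : {x : u n | 0 < ν (closedBall (x : X) (r n))} = univ :=
      eq_univ_of_forall fun x => hpos n x (hu n x.2)
    rw [huniv] at this
    exact countable_univ_iff.1 this
  have hdiam : ∀ n (x : u n), ediam (closedBall (x : X) (5 * r n)) ≤ 10 * r n := fun n x => by
    have : closedBall (x : X) (5 * r n) = closedEBall (x : X) (5 * r n : ℝ≥0) := by
      rw [closedEBall_coe]; simp
    rw [this]
    refine ediam_closedEBall_le.trans (le_of_eq ?_)
    push_cast
    rw [← mul_assoc]; norm_num
  have hsum : ∀ n, ∑' x : u n, ediam (closedBall (x : X) (5 * r n)) ^ (d : ℝ)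
      ≤ 10 ^ (d : ℝ) * (a : ℝ≥0∞)⁻¹ * ν univ := fun n => by
    have ha' : (a : ℝ≥0∞) ≠ 0 := by exact_mod_cast ha.ne'
    calc ∑' x : u n, ediam (closedBall (x : X) (5 * r n)) ^ (d : ℝ)
        ≤ ∑' x : u n, 10 ^ (d : ℝ) * (a : ℝ≥0∞)⁻¹ * ν (closedBall (x : X) (r n)) := by
          refine ENNReal.tsum_le_tsum fun x => ?_
          refine (ENNReal.rpow_le_rpow (hdiam n x) d.coe_nonneg).trans ?_
          rw [ENNReal.mul_rpow_of_nonneg _ _ d.coe_nonneg, mul_assoc]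
          refine mul_le_mul_right ?_ _
          rw [← ENNReal.div_eq_inv_mul]
          refine (ENNReal.le_div_iff_mul_le (Or.inl ha') (Or.inl ENNReal.coe_ne_top)).2 ?_
          rw [mul_comm]
          exact hball x (hu n x.2) (r n) (hr0 n) (hr1 n)
      _ = 10 ^ (d : ℝ) * (a : ℝ≥0∞)⁻¹ * ∑' x : u n, ν (closedBall (x : X) (r n)) :=
          ENNReal.tsum_mul_left
      _ ≤ _ := by
          gcongr
          exact (tsum_meas_le_meas_iUnion_of_disjoint ν
            (fun x : u n => isClosed_closedBall.measurableSet) (hdis' n)).trans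
            (measure_mono (subset_univ _))
  have hlim : Tendsto (fun n => 10 * (r n : ℝ≥0∞)) atTop (𝓝 0) := by
    have h0 : Tendsto (fun n => (r n : ℝ≥0∞)) atTop (𝓝 0) := by
      exact (ENNReal.tendsto_coe (a := 0)).2 (tendsto_one_div_add_atTop_nhds_zero_nat (𝕜 := ℝ≥0))
    simpa using ENNReal.Tendsto.const_mul (a := 10) h0 (Or.inr (by simp))
  have hH := Measure.hausdorffMeasure_le_liminf_tsum (d : ℝ) Λ (fun n => 10 * (r n : ℝ≥0∞)) hlim
    (fun n (x : u n) => closedBall (x : X) (5 * r n)) (Eventually.of_forall hdiam)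
    (Eventually.of_forall fun n x hx => by
      obtain ⟨y, hy, hxy⟩ := hcov n x hx
      exact mem_iUnion.2 ⟨⟨y, hy⟩, hxy (mem_closedBall_self (hr0 n).le)⟩)
  refine dimH_le_of_hausdorffMeasure_ne_top (ne_top_of_le_ne_top ?_ (hH.trans
    (liminf_le_of_frequently_le' (Frequently.of_forall hsum))))
  have ha' : (a : ℝ≥0∞) ≠ 0 := by exact_mod_cast ha.ne'
  exact ENNReal.mul_ne_top (ENNReal.mul_ne_top (by simp) (ENNReal.inv_ne_top.2 ha'))
    (measure_ne_top _ _)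

end Regular

section Symbolic

variable {m : ℕ}

/-- The contraction ratio of the composition of the first `n` maps along `s`. -/
def prefixRatio (c : Fin m → ℝ≥0) (s : ℕ → Fin m) (n : ℕ) : ℝ≥0 :=
  ∏ k ∈ Finset.range n, c (s k)

theorem prefixRatio_succ (c : Fin m → ℝ≥0) (s : ℕ → Fin m) (n : ℕ) :
    prefixRatio c s (n + 1) = prefixRatio c s n * c (s n) :=
  Finset.prod_range_succ _ _

theorem prefixRatio_succ' (c : Fin m → ℝ≥0) (s : ℕ → Fin m) (n : ℕ) :
    prefixRatio c s (n + 1) = c (s 0) * prefixRatio c (shiftMap s) n := by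
  rw [prefixRatio, Finset.prod_range_succ', mul_comm]; rfl

theorem exists_forall_prefixRatio_le {c : Fin m → ℝ≥0} (hc : ∀ i, c i < 1) {ε : ℝ≥0}
    (hε : 0 < ε) : ∃ n, ∀ s, prefixRatio c s n ≤ ε := by
  set ρ := Finset.univ.sup c
  have hρ : ρ < 1 := (Finset.sup_lt_iff (by simp)).2 fun i _ => hc i
  obtain ⟨n, hn⟩ := NNReal.exists_pow_lt_of_lt_one hε hρ
  refine ⟨n, fun s => le_trans ?_ hn.le⟩
  calc prefixRatio c s n ≤ ∏ _k ∈ Finset.range n, ρ :=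
        Finset.prod_le_prod' fun k _ => Finset.le_sup (Finset.mem_univ _)
    _ = ρ ^ n := by simp

/-- The solution of the Moran equation. -/
theorem exists_sum_rpow_eq_one (hm : 2 ≤ m) {c : Fin m → ℝ≥0} (hc0 : ∀ i, 0 < c i)
    (hc1 : ∀ i, c i < 1) : ∃ d : ℝ≥0, ∑ i, c i ^ (d : ℝ) = 1 := by
  have hcont : Continuous fun d : ℝ≥0 => ∑ i, c i ^ (d : ℝ) :=
    continuous_finsetSum _ fun i _ => by
      rw [continuous_iff_continuousAt]
      exact fun d => (NNReal.continuousAt_rpow (Or.inl (hc0 i).ne')).comp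
        (f := fun d : ℝ≥0 => (c i, (d : ℝ))) (by fun_prop)
  have hlim : Tendsto (fun n : ℕ => ∑ i, c i ^ (((n : ℝ≥0)) : ℝ)) atTop (𝓝 0) := by
    have : Tendsto (fun n : ℕ => ∑ i, c i ^ n) atTop (𝓝 (∑ _i : Fin m, 0)) :=
      tendsto_finsetSum _ fun i _ => NNReal.tendsto_pow_atTop_nhds_zero_of_lt_one (hc1 i)
    simpa using this
  obtain ⟨n, hn⟩ := (hlim.eventually (gt_mem_nhds one_pos)).exists
  have := mem_range_of_exists_le_of_exists_ge hcont ⟨(n : ℝ≥0), hn.le⟩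
    ⟨0, by simpa using (by exact_mod_cast (by omega : 1 ≤ m) : (1 : ℝ≥0) ≤ m)⟩
  exact this

/-- The Bernoulli measure on sequences with independent coordinates of law `p`. -/
def bernoulliMeasure (p : PMF (Fin m)) : Measure (ℕ → Fin m) :=
  Measure.infinitePi fun _ => p.toMeasure

instance (p : PMF (Fin m)) : IsProbabilityMeasure (bernoulliMeasure p) := by
  unfold bernoulliMeasure; infer_instance

theorem bernoulliMeasure_cylinder (p : PMF (Fin m)) (F : Finset ℕ) (s : ℕ → Fin m) :
    bernoulliMeasure p {t | ∀ k ∈ F, t k = s k} = ∏ k ∈ F, p (s k) := by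
  have : {t : ℕ → Fin m | ∀ k ∈ F, t k = s k} = Set.pi F fun k => {s k} := by
    ext; simp [Set.mem_pi]
  rw [this, bernoulliMeasure, Measure.infinitePi_pi _ fun _ _ => measurableSet_singleton _]
  exact Finset.prod_congr rfl fun k _ => p.toMeasure_apply_singleton _ (measurableSet_singleton _)

theorem bernoulliMeasure_initialSegment {p : PMF (Fin m)} {c : Fin m → ℝ≥0} {d : ℝ≥0}
    (hp : ∀ i, p i = (c i : ℝ≥0∞) ^ (d : ℝ)) (s : ℕ → Fin m) (n : ℕ) :
    bernoulliMeasure p {t | ∀ k < n, t k = s k} = (prefixRatio c s n : ℝ≥0∞) ^ (d : ℝ) := by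
  have := bernoulliMeasure_cylinder p (Finset.range n) s
  simp only [Finset.mem_range] at this
  simp only [this, hp, prefixRatio, ENNReal.ofNNReal_finsetProd,
    ENNReal.prod_rpow_of_nonneg d.coe_nonneg]

theorem ae_frequently_block_eq {p : PMF (Fin m)} (hp : ∀ i, p i ≠ 0) (u : ℕ → Fin m) (k : ℕ) :
    ∀ᵐ t ∂bernoulliMeasure p, ∃ᶠ j in atTop, ∀ i < k, t (j * k + i) = u (j * k + i) := by
  have hm : Nonempty (Fin m) := ⟨u 0⟩
  set E : ℕ → Set (ℕ → Fin m) := fun j => {t | ∀ i < k, t (j * k + i) = u (j * k + i)} with hE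
  set g : ℕ × ℕ → ℕ := fun q => q.1 * k + q.2 with hg
  have hinj : ∀ J : Finset ℕ, Set.InjOn g (J ×ˢ Finset.range k : Finset (ℕ × ℕ)) := by
    rintro J ⟨j, i⟩ h ⟨j', i'⟩ h' heq
    simp only [Finset.coe_product, Finset.coe_range, Set.mem_prod, Set.mem_Iio] at h h'
    have hk : 0 < k := by omega
    have h1 := congrArg (· / k) heq
    have h2 := congrArg (· % k) heq
    simp only [hg, Nat.mul_comm _ k, Nat.mul_add_div hk, Nat.div_eq_of_lt h.2,
      Nat.div_eq_of_lt h'.2, Nat.mul_add_mod, Nat.mod_eq_of_lt h.2, Nat.mod_eq_of_lt h'.2] at h1 h2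
    simp only [Prod.mk.injEq]
    omega
  have hmeas : ∀ J : Finset ℕ, bernoulliMeasure p (⋂ j ∈ J, E j)
      = ∏ j ∈ J, ∏ i ∈ Finset.range k, p (u (j * k + i)) := by
    intro J
    have hset : (⋂ j ∈ J, E j)
        = {t | ∀ n ∈ (J ×ˢ Finset.range k).image g, t n = u n} := by
      ext t
      simp only [hE, hg, Set.mem_iInter, Set.mem_ofPred_eq, Finset.mem_image, Finset.mem_product,
        Finset.mem_range, Prod.exists]
      constructor
      · rintro h n ⟨j, i, ⟨hj, hi⟩, rfl⟩
        exact h j hj i hi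
      · exact fun h j hj i hi => h _ ⟨j, i, ⟨hj, hi⟩, rfl⟩
    rw [hset, bernoulliMeasure_cylinder, Finset.prod_image (hinj J), Finset.prod_product]
  have hmeasE : ∀ j, bernoulliMeasure p (E j) = ∏ i ∈ Finset.range k, p (u (j * k + i)) := by
    intro j
    simpa using hmeas {j}
  have hmE : ∀ j, MeasurableSet (E j) := fun j => by
    simp only [hE, Set.ofPred_forall]
    exact MeasurableSet.iInter fun i => MeasurableSet.iInter fun _ =>
      measurableSet_eq_fun (measurable_pi_apply _) measurable_const
  have hind : ProbabilityTheory.iIndepSet E (bernoulliMeasure p) := by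
    rw [ProbabilityTheory.iIndepSet_iff_meas_biInter hmE]
    intro J
    rw [hmeas]
    exact Finset.prod_congr rfl fun j _ => (hmeasE j).symm
  obtain ⟨i₀, hi₀⟩ := Finite.exists_min p
  have hsum : ∑' j, bernoulliMeasure p (E j) = ∞ := by
    refine top_unique ?_
    rw [← ENNReal.tsum_const_eq_top_of_ne_zero (α := ℕ) (pow_ne_zero k (hp i₀))]
    refine ENNReal.tsum_le_tsum fun j => ?_
    rw [hmeasE]
    calc p i₀ ^ k = ∏ _i ∈ Finset.range k, p i₀ := by simp
      _ ≤ _ := Finset.prod_le_prod' fun i _ => hi₀ _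
  have h1 := ProbabilityTheory.measure_limsup_eq_one hmE hind hsum
  have h2 : ∀ᵐ t ∂bernoulliMeasure p, t ∈ limsup E atTop :=
    (prob_compl_eq_zero_iff (.measurableSet_limsup hmE)).2 h1
  filter_upwards [h2] with t ht
  exact mem_limsup_iff_frequently_mem.1 ht

/-- The pairs of sequences that agree on arbitrarily long blocks arbitrarily far out, and that
differ at arbitrarily large positions. -/
def symbolicLiYorkePairs (m : ℕ) : Set ((ℕ → Fin m) × (ℕ → Fin m)) :=
  {q | (∀ k, ∃ᶠ n in atTop, ∀ i < k, q.1 (n + i) = q.2 (n + i)) ∧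
    ∃ᶠ n in atTop, q.1 n ≠ q.2 n}

theorem measurableSet_symbolicLiYorkePairs : MeasurableSet (symbolicLiYorkePairs m) := by
  have hE : ∀ n, MeasurableSet {q : (ℕ → Fin m) × (ℕ → Fin m) | q.1 n = q.2 n} := fun n =>
    measurableSet_eq_fun ((measurable_pi_apply n).comp measurable_fst)
      ((measurable_pi_apply n).comp measurable_snd)
  simp only [symbolicLiYorkePairs, frequently_atTop, Set.ofPred_and, Set.ofPred_forall,
    Set.ofPred_exists]
  refine .inter (.iInter fun k => .iInter fun N => .iUnion fun n => .inter (.const _)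
    (.iInter fun i => .iInter fun _ => hE _)) (.iInter fun N => .iUnion fun n =>
    .inter (.const _) (hE n).compl)

theorem ae_mem_symbolicLiYorkePairs (hm : 2 ≤ m) {p : PMF (Fin m)} (hp : ∀ i, p i ≠ 0) :
    ∀ᵐ q ∂(bernoulliMeasure p).prod (bernoulliMeasure p), q ∈ symbolicLiYorkePairs m := by
  rw [Measure.ae_prod_mem_iff_ae_ae_mem measurableSet_symbolicLiYorkePairs]
  refine Eventually.of_forall fun s => ?_
  have : Nontrivial (Fin m) := Fin.nontrivial_iff_two_le.2 hm
  choose v hv using fun n => exists_ne (s n)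
  filter_upwards [ae_all_iff.2 fun k => ae_frequently_block_eq hp s (k + 1),
    ae_frequently_block_eq hp v 1] with t ht htv
  refine ⟨fun k => ?_, ?_⟩
  · have hlim : Tendsto (fun j : ℕ => j * (k + 1)) atTop atTop :=
      tendsto_id.atTop_mul_const' (Nat.succ_pos k)
    exact hlim.frequently ((ht k).mono fun j hj i hi => (hj i (by omega)).symm)
  · refine htv.mono fun j hj => ?_
    have := hj 0 one_pos
    simp only [mul_one, add_zero] at this
    show s j ≠ t j
    rw [this]
    exact (hv j).symm

end Symbolic

section Coding

variable {m : ℕ} {X : Type*} [MetricSpace X] [MeasurableSpace X] [BorelSpace X]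
  {π : (ℕ → Fin m) → X} {c : Fin m → ℝ≥0} {p : PMF (Fin m)} {d : ℝ≥0}

omit [BorelSpace X] in
theorem lowerRegular_map_bernoulliMeasure (hπ : Measurable π) (hc0 : ∀ i, 0 < c i)
    (hc1 : ∀ i, c i < 1) (hp : ∀ i, p i = (c i : ℝ≥0∞) ^ (d : ℝ)) {M : ℝ≥0}
    (hM : ∀ s t n, (∀ k < n, t k = s k) → nndist (π t) (π s) ≤ M * prefixRatio c s n) :
    LowerRegular ((bernoulliMeasure p).map π) d (range π) := by
  rcases isEmpty_or_nonempty (Fin m) with h | h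
  · exact ⟨1, one_pos, by rintro x ⟨s, -⟩; exact isEmptyElim (s 0)⟩
  obtain ⟨i₀, hi₀⟩ := Finite.exists_min c
  set κ : ℝ≥0 := c i₀ / (M + 1) with hκ
  have hκ0 : 0 < κ := div_pos (hc0 i₀) (by positivity)
  have hκ1 : κ ≤ 1 := div_le_one_of_le₀ ((hc1 i₀).le.trans (by simp)) (by positivity)
  refine ⟨κ ^ (d : ℝ), NNReal.rpow_pos hκ0, ?_⟩
  rintro _ ⟨s, rfl⟩ r hr hr1
  have hex : ∃ n, M * prefixRatio c s n ≤ r := by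
    obtain ⟨n, hn⟩ := exists_forall_prefixRatio_le hc1 (div_pos hr (by positivity : 0 < M + 1))
    refine ⟨n, ?_⟩
    calc M * prefixRatio c s n ≤ (M + 1) * (r / (M + 1)) := mul_le_mul' (by simp) (hn s)
      _ = r := mul_div_cancel₀ _ (by positivity)
  classical
  obtain ⟨n, hn, hκr⟩ : ∃ n, M * prefixRatio c s n ≤ r ∧ κ * r ≤ prefixRatio c s n := by
    refine ⟨Nat.find hex, Nat.find_spec hex, ?_⟩
    rcases hfind : Nat.find hex with _ | k
    · simpa [prefixRatio] using mul_le_one' hκ1 hr1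
    · have hk : r < M * prefixRatio c s k := not_le.1 (Nat.find_min hex (by omega))
      rw [prefixRatio_succ, hκ, div_mul_eq_mul_div, mul_comm (prefixRatio _ _ _), mul_div_assoc]
      refine mul_le_mul' (hi₀ _) (div_le_of_le_mul₀ (by positivity) (by positivity) ?_)
      exact hk.le.trans (by rw [mul_comm]; gcongr; simp)
  calc ((κ ^ (d : ℝ) : ℝ≥0) : ℝ≥0∞) * (r : ℝ≥0∞) ^ (d : ℝ)
      = ((κ * r : ℝ≥0) : ℝ≥0∞) ^ (d : ℝ) := by
        rw [ENNReal.coe_mul, ENNReal.mul_rpow_of_nonneg _ _ d.coe_nonneg,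
          ENNReal.coe_rpow_of_nonneg _ d.coe_nonneg]
    _ ≤ (prefixRatio c s n : ℝ≥0∞) ^ (d : ℝ) := by gcongr
    _ = bernoulliMeasure p {t | ∀ k < n, t k = s k} := (bernoulliMeasure_initialSegment hp s n).symm
    _ ≤ bernoulliMeasure p (π ⁻¹' closedBall (π s) r) :=
        measure_mono fun t ht => mem_closedBall.2 (by exact_mod_cast (hM s t n ht).trans hn)
    _ ≤ _ := Measure.le_map_apply hπ.aemeasurable _

theorem upperRegular_map_bernoulliMeasure (hπ : Measurable π)
    (hc1 : ∀ i, c i < 1) (hp : ∀ i, p i = (c i : ℝ≥0∞) ^ (d : ℝ)) {δ : ℝ≥0} (hδ0 : 0 < δ)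
    (hδ : ∀ s t n, (∀ k < n, t k = s k) → t n ≠ s n →
      δ * prefixRatio c s n ≤ nndist (π t) (π s)) :
    UpperRegular ((bernoulliMeasure p).map π) d := by
  refine ⟨(1 / δ) ^ (d : ℝ), fun A r hr hA => ?_⟩
  refine (measure_mono subset_closure).trans ?_
  rw [Measure.map_apply hπ isClosed_closure.measurableSet]
  rw [← ediam_closure] at hA
  rcases (π ⁻¹' closure A).eq_empty_or_nonempty with h | ⟨s, hs⟩
  · simp [h]
  have hex : ∃ n, δ * prefixRatio c s n ≤ r := by
    obtain ⟨n, hn⟩ := exists_forall_prefixRatio_le hc1 (div_pos hr hδ0)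
    exact ⟨n, (mul_le_mul' le_rfl (hn s)).trans (mul_div_cancel₀ _ hδ0.ne').le⟩
  classical
  set n := Nat.find hex
  have hsub : π ⁻¹' closure A ⊆ {t | ∀ k < n, t k = s k} := by
    intro t ht
    by_contra hcon
    have hex' : ∃ k, t k ≠ s k := by
      simp only [Set.mem_ofPred_eq, not_forall] at hcon
      obtain ⟨k, -, hk⟩ := hcon
      exact ⟨k, hk⟩
    have hlt : Nat.find hex' < n := by
      by_contra hge
      exact hcon fun k hk => not_not.1 (Nat.find_min hex' (by omega))
    refine Nat.find_min hex hlt ((hδ s t _ (fun k hk => not_not.1 (Nat.find_min hex' hk))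
      (Nat.find_spec hex')).trans ?_)
    have := (edist_le_ediam_of_mem (show π t ∈ closure A from ht) hs).trans hA
    rw [edist_nndist] at this
    exact_mod_cast this
  calc bernoulliMeasure p (π ⁻¹' closure A) ≤ bernoulliMeasure p {t | ∀ k < n, t k = s k} :=
        measure_mono hsub
    _ = (prefixRatio c s n : ℝ≥0∞) ^ (d : ℝ) := bernoulliMeasure_initialSegment hp s n
    _ ≤ ((1 / δ * r : ℝ≥0) : ℝ≥0∞) ^ (d : ℝ) := by
        gcongr
        rw [one_div_mul_eq_div, le_div_iff₀ hδ0, mul_comm]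
        exact Nat.find_spec hex
    _ = _ := by
        rw [ENNReal.coe_mul, ENNReal.mul_rpow_of_nonneg _ _ d.coe_nonneg,
          ENNReal.coe_rpow_of_nonneg _ d.coe_nonneg]

omit [MeasurableSpace X] [BorelSpace X] in
theorem mem_liYorkePairs_of_mem_symbolicLiYorkePairs {f : X → X}
    (hconj : ∀ s, f (π s) = π (shiftMap s)) (hc1 : ∀ i, c i < 1) {M : ℝ≥0}
    (hM : ∀ s t n, (∀ k < n, t k = s k) → nndist (π t) (π s) ≤ M * prefixRatio c s n)
    {δ : ℝ≥0} (hδ0 : 0 < δ) (hδ : ∀ s t, t 0 ≠ s 0 → δ ≤ nndist (π t) (π s))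
    {q : (ℕ → Fin m) × (ℕ → Fin m)} (hq : q ∈ symbolicLiYorkePairs m) :
    (π q.1, π q.2) ∈ liYorkePairs f (range π) := by
  have hiter : ∀ (n : ℕ) s, f^[n] (π s) = π fun k => s (n + k) := by
    intro n
    induction n with
    | zero => intro s; simp
    | succ n ih =>
      intro s
      rw [Function.iterate_succ_apply, hconj, ih]
      congr 1
      funext k
      simp only [shiftMap]
      congr 1
      omega
  obtain ⟨hagree, hdiff⟩ := hq
  refine ⟨mem_range_self _, mem_range_self _, ?_⟩
  simp only [hiter]
  have hbdd : IsBoundedUnder (· ≤ ·) atTop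
      fun n : ℕ => dist (π fun k => q.1 (n + k)) (π fun k => q.2 (n + k)) :=
    isBoundedUnder_of ⟨M, fun n => by
      simpa [prefixRatio] using hM (fun k => q.2 (n + k)) (fun k => q.1 (n + k)) 0 (by simp)⟩
  have hbdd' : IsBoundedUnder (· ≥ ·) atTop
      fun n : ℕ => dist (π fun k => q.1 (n + k)) (π fun k => q.2 (n + k)) :=
    isBoundedUnder_of ⟨0, fun n => dist_nonneg⟩
  constructor
  · refine le_antisymm (le_of_forall_pos_le_add fun ε hε => ?_)
      (le_liminf_of_le hbdd.isCoboundedUnder_ge (Eventually.of_forall fun n => dist_nonneg))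
    lift ε to ℝ≥0 using hε.le
    obtain ⟨k, hk⟩ := exists_forall_prefixRatio_le hc1
      (div_pos (NNReal.coe_pos.1 hε) (by positivity : 0 < M + 1))
    refine liminf_le_of_frequently_le ((hagree k).mono fun n hn => ?_) hbdd'
    rw [zero_add, ← coe_nndist, NNReal.coe_le_coe]
    calc _ ≤ M * prefixRatio c (fun k => q.2 (n + k)) k := hM _ _ k hn
      _ ≤ (M + 1) * (ε / (M + 1)) := mul_le_mul' (by simp) (hk _)
      _ = ε := mul_div_cancel₀ _ (by positivity)
  · refine lt_of_lt_of_le (NNReal.coe_pos.2 hδ0)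
      (le_limsup_of_frequently_le (hdiff.mono fun n hn => ?_) hbdd)
    rw [← coe_nndist, NNReal.coe_le_coe]
    exact hδ _ _ hn

theorem dimH_liYorkePairs_range [SecondCountableTopology X] {f : X → X}
    (hm : 2 ≤ m) (hπ : Measurable π) (hconj : ∀ s, f (π s) = π (shiftMap s))
    (hc0 : ∀ i, 0 < c i) (hc1 : ∀ i, c i < 1) {M : ℝ≥0}
    (hM : ∀ s t n, (∀ k < n, t k = s k) → nndist (π t) (π s) ≤ M * prefixRatio c s n)
    {δ : ℝ≥0} (hδ0 : 0 < δ)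
    (hδ : ∀ s t n, (∀ k < n, t k = s k) → t n ≠ s n →
      δ * prefixRatio c s n ≤ nndist (π t) (π s)) :
    dimH (liYorkePairs f (range π)) = dimH (range π ×ˢ range π) ∧
      dimH (range π ×ˢ range π) = 2 * dimH (range π) := by
  obtain ⟨d, hd⟩ := exists_sum_rpow_eq_one hm hc0 hc1
  let p : PMF (Fin m) := PMF.ofFintype (fun i => (c i : ℝ≥0∞) ^ (d : ℝ)) (by
    rw [← ENNReal.coe_one, ← hd, ENNReal.ofNNReal_finsetSum]
    exact Finset.sum_congr rfl fun i _ => (ENNReal.coe_rpow_of_nonneg _ d.coe_nonneg).symm)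
  have hp : ∀ i, p i = (c i : ℝ≥0∞) ^ (d : ℝ) := fun i => PMF.ofFintype_apply _ _
  have hp0 : ∀ i, p i ≠ 0 := fun i => by
    rw [hp]
    exact (ENNReal.rpow_pos (by exact_mod_cast hc0 i) ENNReal.coe_ne_top).ne'
  set ν := (bernoulliMeasure p).map π with hν
  have : IsProbabilityMeasure ν := Measure.isProbabilityMeasure_map hπ.aemeasurable
  have hlow : LowerRegular ν d (range π) := lowerRegular_map_bernoulliMeasure hπ hc0 hc1 hp hM
  have hup : UpperRegular ν d := upperRegular_map_bernoulliMeasure hπ hc1 hp hδ0 hδ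
  have hLY : ν.prod ν (liYorkePairs f (range π)) ≠ 0 := by
    rw [hν, Measure.map_prod_map _ _ hπ hπ]
    have hae := ae_mem_symbolicLiYorkePairs hm hp0
    have h1 : (bernoulliMeasure p).prod (bernoulliMeasure p)
        (Prod.map π π ⁻¹' liYorkePairs f (range π)) = 1 := by
      rw [← measure_univ (μ := (bernoulliMeasure p).prod (bernoulliMeasure p))]
      refine measure_congr (eventuallyEq_univ.2 ?_)
      filter_upwards [hae] with q hq
      exact mem_liYorkePairs_of_mem_symbolicLiYorkePairs hconj hc1 hM hδ0
        (fun s t h => by simpa [prefixRatio] using hδ s t 0 (by simp) h) hq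
    have h2 := Measure.le_map_apply (μ := (bernoulliMeasure p).prod (bernoulliMeasure p))
      (hπ.prodMap hπ).aemeasurable (liYorkePairs f (range π))
    rw [h1] at h2
    exact (one_pos.trans_le h2).ne'
  have hν0 : ν (range π) ≠ 0 := by
    have h2 := Measure.le_map_apply (μ := bernoulliMeasure p) hπ.aemeasurable (range π)
    rw [preimage_range, measure_univ] at h2
    exact (one_pos.trans_le h2).ne'
  have hdim : dimH (range π) = d := le_antisymm hlow.dimH_le (hup.le_dimH hν0)
  have hupper : dimH (range π ×ˢ range π) ≤ ((d + d : ℝ≥0) : ℝ≥0∞) := by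
    refine LowerRegular.dimH_le (ν := ν.prod ν) ?_
    exact hlow.prod d.2 d.2 hlow
  have hlower : ((d + d : ℝ≥0) : ℝ≥0∞) ≤ dimH (liYorkePairs f (range π)) := by
    refine UpperRegular.le_dimH (ν := ν.prod ν) ?_ hLY
    exact hup.prod d.2 d.2 hup
  have hmono : dimH (liYorkePairs f (range π)) ≤ dimH (range π ×ˢ range π) :=
    dimH_mono fun q hq => ⟨hq.1, hq.2.1⟩
  refine ⟨le_antisymm hmono (hupper.trans hlower), ?_⟩
  rw [hdim, two_mul]
  exact_mod_cast le_antisymm hupper (hlower.trans hmono)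

omit [MetricSpace X] [MeasurableSpace X] [BorelSpace X] in
theorem map_coding_eq_coding_shift {S : Fin m → X → X} {K : Set X}
    (hSK : ∀ i, S i '' K ⊆ K) (hπ : ∀ s, (⋂ n, iterComp S s n '' K) = {π s}) (s : ℕ → Fin m) :
    π s = S (s 0) (π (shiftMap s)) := by
  have hsucc : ∀ n, iterComp S s (n + 1) = S (s 0) ∘ iterComp S (shiftMap s) n := by
    intro n
    induction n with
    | zero => rfl
    | succ n ih => rw [iterComp, ih]; rfl
  have hmem : ∀ n, π (shiftMap s) ∈ iterComp S (shiftMap s) n '' K := by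
    have h : π (shiftMap s) ∈ ⋂ n, iterComp S (shiftMap s) n '' K := by rw [hπ]; rfl
    exact mem_iInter.1 h
  have h : S (s 0) (π (shiftMap s)) ∈ ⋂ n, iterComp S s n '' K := by
    refine mem_iInter.2 fun n => ?_
    cases n with
    | zero => exact mem_image_of_mem _ (hSK _ (hmem 0))
    | succ n => rw [hsucc, image_comp]; exact mem_image_of_mem _ (hmem n)
  rw [hπ] at h
  exact h.symm

omit [MeasurableSpace X] [BorelSpace X] in
theorem nndist_coding_eq_prefixRatio_mul {S : Fin m → X → X}
    (hS : ∀ i x y, nndist (S i x) (S i y) = c i * nndist x y)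
    (hshift : ∀ s, π s = S (s 0) (π (shiftMap s))) (n : ℕ) :
    ∀ s t : ℕ → Fin m, (∀ k < n, t k = s k) → nndist (π t) (π s) =
      prefixRatio c s n * nndist (π fun k => t (n + k)) (π fun k => s (n + k)) := by
  induction n with
  | zero => intro s t _; simp [prefixRatio]
  | succ n ih =>
    intro s t h
    have heq : ∀ u : ℕ → Fin m, (fun k => shiftMap u (n + k)) = fun k => u (n + 1 + k) := by
      intro u; funext k; simp only [shiftMap]; congr 1; omega
    rw [hshift t, hshift s, h 0 (by omega), hS,
      ih (shiftMap s) (shiftMap t) fun k hk => h (k + 1) (by omega), prefixRatio_succ', heq, heq,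
      mul_assoc]

end Coding

/-- Let `S_1,…,S_m` (`m ≥ 2`) be contracting similitudes of `ℝ^w` with
separated compact `K`, let `Λ` be the self-similar attractor with coding map `π`, and let
`f : ℝ^w → ℝ^w` satisfy `f(Λ) = Λ`, with `π` a homeomorphism from `Σ` onto `Λ` conjugating
the shift `σ` to `f`. Then the Li-Yorke pairs of `f` in `Λ` have full Hausdorff dimension:
`dim_H LY_f(Λ) = dim_H (Λ × Λ) = 2 · dim_H Λ`. -/
theorem dimH_liYorkePairs_eq_of_conj_one_sided_shift (m w : ℕ) (hm : 2 ≤ m)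
    (S : Fin m → EuclideanSpace ℝ (Fin w) → EuclideanSpace ℝ (Fin w))
    (c : Fin m → ℝ) (hc : ∀ i, c i ∈ Set.Ioo (0 : ℝ) 1)
    (hS : ∀ i x y, dist (S i x) (S i y) = c i * dist x y)
    (K : Set (EuclideanSpace ℝ (Fin w))) (hKc : IsCompact K) (hKne : K.Nonempty)
    (hSK : ∀ i, S i '' K ⊆ K)
    (hdisj : ∀ i j, i ≠ j → Disjoint (S i '' K) (S j '' K))
    (Λ : Set (EuclideanSpace ℝ (Fin w))) (hΛc : IsCompact Λ) (hΛne : Λ.Nonempty)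
    (hΛ : Λ = ⋃ i, S i '' Λ)
    (π : (ℕ → Fin m) → EuclideanSpace ℝ (Fin w))
    (hπ : ∀ s, (⋂ n, iterComp S s n '' K) = {π s})
    (f : EuclideanSpace ℝ (Fin w) → EuclideanSpace ℝ (Fin w))
    (hfΛ : f '' Λ = Λ)
    (e : (ℕ → Fin m) ≃ₜ Λ) (he : ∀ s, (e s : EuclideanSpace ℝ (Fin w)) = π s)
    (hconj : ∀ s : ℕ → Fin m, f (π s) = π (shiftMap s)) :
    dimH (liYorkePairs f Λ) = dimH (Λ ×ˢ Λ) ∧ dimH (Λ ×ˢ Λ) = 2 * dimH Λ := by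
  have hπe : π = Subtype.val ∘ e := funext fun s => (he s).symm
  have hcont : Continuous π := by rw [hπe]; exact continuous_subtype_val.comp e.continuous
  have hinj : Function.Injective π := by
    rw [hπe]; exact Subtype.val_injective.comp e.injective
  have hrange : range π = Λ := by
    rw [hπe, e.surjective.range_comp, Subtype.range_coe]
  lift c to Fin m → ℝ≥0 using fun i => (hc i).1.le
  have hS' : ∀ i x y, nndist (S i x) (S i y) = c i * nndist x y := fun i x y =>
    NNReal.eq (hS i x y)
  have hscale := nndist_coding_eq_prefixRatio_mul hS' (map_coding_eq_coding_shift hSK hπ)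
  have hdistcont : Continuous fun q : (ℕ → Fin m) × (ℕ → Fin m) => nndist (π q.1) (π q.2) := by
    fun_prop
  obtain ⟨M, hM⟩ := (isCompact_range hdistcont).bddAbove
  have : Nontrivial (Fin m) := Fin.nontrivial_iff_two_le.2 hm
  obtain ⟨i, j, hij⟩ := exists_pair_ne (Fin m)
  have hclosed : IsClosed {q : (ℕ → Fin m) × (ℕ → Fin m) | q.1 0 ≠ q.2 0} := by
    have : IsOpen {q : (ℕ → Fin m) × (ℕ → Fin m) | q.1 0 = q.2 0} :=
      (isOpen_discrete {q : Fin m × Fin m | q.1 = q.2}).preimage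
        (f := fun q : (ℕ → Fin m) × (ℕ → Fin m) => (q.1 0, q.2 0)) (by fun_prop)
    exact this.isClosed_compl
  obtain ⟨q₀, hq₀, hmin⟩ := hclosed.isCompact.exists_isMinOn ⟨(fun _ => i, fun _ => j), hij⟩
    hdistcont.continuousOn
  rw [← hrange]
  refine dimH_liYorkePairs_range hm hcont.measurable hconj (fun i => (hc i).1)
    (fun i => (hc i).2) (M := M) (δ := nndist (π q₀.1) (π q₀.2)) ?_ ?_ ?_
  · intro s t n h
    rw [hscale n s t h, mul_comm]
    exact mul_le_mul' (hM ⟨(_, _), rfl⟩) le_rfl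
  · exact pos_iff_ne_zero.2 fun h => hq₀ (by rw [hinj (nndist_eq_zero.1 h)])
  · intro s t n h hne
    rw [hscale n s t h, mul_comm]
    exact mul_le_mul' le_rfl (hmin (a := (fun k => t (n + k), fun k => s (n + k))) hne)

end
end

section
/- Let β₁, β₂ ∈ (0,1) with β₁ + β₂ < 1, and let b : [0,1]² → [0,1]² be the skinny baker's transformation b(x,y) = (β₁x, 2y) if y ≤ 1/2 and b(x,y) = (1 − β₂ + β₂x, 2y − 1) if y > 1/2. Let Λ ⊆ ℝ be the attractor of the iterated function system T₁x = β₁x, T₂x = 1 − β₂ + β₂x, and let D solve β₁^D + β₂^D = 1. Then the Li-Yorke pairs of b in the attractor Λ × [0,1] have full Hausdorff dimension: dim_H LY_b(Λ × [0,1]) = dim_H((Λ × [0,1]) × (Λ × [0,1])) = 2(D + 1). -/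
open Filter Set

noncomputable section

/-- `S` can be covered at every scale `r ≤ 1` by at most `K * r ^ (-s)` balls of radius `r`. -/
def HasCoverBound {X : Type*} [PseudoMetricSpace X] (S : Set X) (s K : ℝ) : Prop :=
  ∀ r ∈ Ioc (0 : ℝ) 1, ∃ t : Finset X,
    S ⊆ ⋃ x ∈ t, Metric.closedBall x r ∧ (t.card : ℝ) ≤ K * r ^ (-s)

theorem HasCoverBound.prod {X Y : Type*} [PseudoMetricSpace X] [PseudoMetricSpace Y]
    {S : Set X} {T : Set Y} {s s' K K' : ℝ} (hS : HasCoverBound S s K)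
    (hT : HasCoverBound T s' K') : HasCoverBound (S ×ˢ T) (s + s') (K * K') := by
  intro r hr
  obtain ⟨t, ht, htc⟩ := hS r hr
  obtain ⟨u, hu, huc⟩ := hT r hr
  refine ⟨t ×ˢ u, ?_, ?_⟩
  · rintro ⟨x, y⟩ ⟨hx, hy⟩
    obtain ⟨a, ha, hxa⟩ := mem_iUnion₂.1 (ht hx)
    obtain ⟨c, hc, hyc⟩ := mem_iUnion₂.1 (hu hy)
    refine mem_iUnion₂.2 ⟨(a, c), Finset.mk_mem_product ha hc, ?_⟩
    rw [← closedBall_prod_same]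
    exact ⟨hxa, hyc⟩
  · rw [Finset.card_product, neg_add, Real.rpow_add hr.1]
    push_cast
    calc (t.card : ℝ) * u.card ≤ (K * r ^ (-s)) * (K' * r ^ (-s')) := by
          gcongr
          exact (Nat.cast_nonneg _).trans htc
      _ = _ := by ring

theorem HasCoverBound.dimH_le {X : Type*} [MetricSpace X] {S : Set X} {s K : ℝ} (hs : 0 ≤ s)
    (hS : HasCoverBound S s K) : dimH S ≤ ENNReal.ofReal s := by
  borelize X
  let r : ℕ → ℝ := fun n => 1 / ((n : ℝ) + 1)
  have hr : ∀ n, r n ∈ Ioc (0 : ℝ) 1 := fun n => by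
    have : (0 : ℝ) < (n : ℝ) + 1 := by positivity
    exact ⟨by positivity, by rw [div_le_one this]; linarith [Nat.cast_nonneg (α := ℝ) n]⟩
  have hr0 : Tendsto r atTop (nhds 0) := tendsto_one_div_add_atTop_nhds_zero_nat
  choose t ht htc using fun n => hS (r n) (hr n)
  have hdiam : ∀ n, ∀ i : t n, Metric.ediam (Metric.closedBall (i : X) (r n)) ≤
      ENNReal.ofReal (2 * r n) := fun n i => by
    refine Metric.ediam_le fun x hx y hy => ?_
    rw [edist_dist]
    refine ENNReal.ofReal_le_ofReal ((dist_triangle_right x y (i : X)).trans ?_)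
    rw [Metric.mem_closedBall] at hx hy
    linarith
  have key := MeasureTheory.Measure.hausdorffMeasure_le_liminf_sum (ι := fun n => t n) s S
    (l := atTop) (fun n => ENNReal.ofReal (2 * r n))
    (by simpa using (ENNReal.tendsto_ofReal (hr0.const_mul 2)))
    (fun n i => Metric.closedBall (i : X) (r n)) (Eventually.of_forall hdiam)
    (Eventually.of_forall fun n => (ht n).trans (by
      intro x hx
      obtain ⟨a, ha, hxa⟩ := mem_iUnion₂.1 hx
      exact mem_iUnion.2 ⟨⟨a, ha⟩, hxa⟩))
  have hbound : ∀ n, ∑ i : t n, Metric.ediam (Metric.closedBall (i : X) (r n)) ^ s ≤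
      ENNReal.ofReal (K * 2 ^ s) := fun n => by
    have hrn := (hr n).1
    calc ∑ i : t n, Metric.ediam (Metric.closedBall (i : X) (r n)) ^ s
        ≤ ∑ _i : t n, ENNReal.ofReal ((2 * r n) ^ s) := by
          refine Finset.sum_le_sum fun i _ => ?_
          rw [← ENNReal.ofReal_rpow_of_pos (by positivity)]
          exact ENNReal.rpow_le_rpow (hdiam n i) hs
      _ = ENNReal.ofReal ((t n).card * (2 * r n) ^ s) := by
          rw [ENNReal.ofReal_mul (Nat.cast_nonneg _)]
          simp
      _ ≤ _ := by
          refine ENNReal.ofReal_le_ofReal ?_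
          calc ((t n).card : ℝ) * (2 * r n) ^ s ≤ (K * r n ^ (-s)) * (2 * r n) ^ s := by
                gcongr
                exact htc n
            _ = K * 2 ^ s * (r n ^ (-s) * r n ^ s) := by
                rw [Real.mul_rpow (by norm_num) hrn.le]; ring
            _ = K * 2 ^ s := by
                rw [← Real.rpow_add hrn]; simp
  have hfin : MeasureTheory.Measure.hausdorffMeasure s S ≠ ⊤ := by
    refine ne_top_of_le_ne_top (ENNReal.ofReal_ne_top (r := K * 2 ^ s)) (key.trans ?_)
    exact liminf_le_of_frequently_le' (Frequently.of_forall hbound)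
  have := dimH_le_of_hausdorffMeasure_ne_top (d := s.toNNReal) (s := S)
    (by rwa [Real.coe_toNNReal s hs])
  exact this

theorem hasCoverBound_of_subset_union {β₁ β₂ D : ℝ} (hβ₁ : β₁ ∈ Ioo (0 : ℝ) 1)
    (hβ₂ : β₂ ∈ Ioo (0 : ℝ) 1) (hD0 : 0 ≤ D) (hD : β₁ ^ D + β₂ ^ D = 1) {Λ : Set ℝ}
    (hΛI : Λ ⊆ Icc 0 1)
    (hΛ : Λ ⊆ (fun x => β₁ * x) '' Λ ∪ (fun x => 1 - β₂ + β₂ * x) '' Λ) :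
    ∃ K, HasCoverBound Λ D K := by
  classical
  obtain ⟨h10, h11⟩ := hβ₁
  obtain ⟨h20, h21⟩ := hβ₂
  set m := min β₁ β₂ with hm
  set M := max β₁ β₂ with hM
  have hm0 : 0 < m := lt_min h10 h20
  have hm1 : m ≤ 1 := (min_le_left _ _).trans h11.le
  have hM1 : M < 1 := max_lt h11 h21
  have hM0 : 0 < M := lt_max_of_lt_left h10
  set K := (1 / m) ^ D with hK
  have main : ∀ k : ℕ, ∀ r, M ^ k ≤ r → r ≤ 1 / m → ∃ t : Finset ℝ,
      Λ ⊆ ⋃ x ∈ t, Metric.closedBall x r ∧ (t.card : ℝ) ≤ K * r ^ (-D) := by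
    have big : ∀ r, 1 ≤ r → r ≤ 1 / m → ∃ t : Finset ℝ,
        Λ ⊆ ⋃ x ∈ t, Metric.closedBall x r ∧ (t.card : ℝ) ≤ K * r ^ (-D) := by
      intro r hr hrm
      refine ⟨{0}, fun x hx => ?_, ?_⟩
      · have := hΛI hx
        simp only [Finset.mem_singleton, iUnion_iUnion_eq_left, Metric.mem_closedBall,
          Real.dist_eq, sub_zero, abs_of_nonneg this.1]
        exact this.2.trans hr
      · have hr0 : 0 < r := by linarith
        rw [Real.rpow_neg hr0.le, ← div_eq_mul_inv, le_div_iff₀ (by positivity)]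
        simpa [hK] using Real.rpow_le_rpow hr0.le hrm hD0
    intro k
    induction k with
    | zero => intro r hr hrm; exact big r (by simpa using hr) hrm
    | succ k ih =>
      intro r hr hrm
      rcases le_or_gt 1 r with h1 | h1
      · exact big r h1 hrm
      have hr0 : 0 < r := lt_of_lt_of_le (by positivity) hr
      have hscale : ∀ β, 0 < β → m ≤ β → β ≤ M → M ^ k ≤ r / β ∧ r / β ≤ 1 / m := by
        intro β hβ hmβ hβM
        constructor
        · rw [le_div_iff₀ hβ]
          calc M ^ k * β ≤ M ^ k * M := by gcongr
            _ ≤ r := by rwa [← pow_succ]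
        · gcongr
      obtain ⟨t, ht, htc⟩ := ih (r / β₁) (hscale β₁ h10 (min_le_left _ _) (le_max_left _ _)).1
        (hscale β₁ h10 (min_le_left _ _) (le_max_left _ _)).2
      obtain ⟨u, hu, huc⟩ := ih (r / β₂) (hscale β₂ h20 (min_le_right _ _) (le_max_right _ _)).1
        (hscale β₂ h20 (min_le_right _ _) (le_max_right _ _)).2
      refine ⟨t.image (fun x => β₁ * x) ∪ u.image (fun x => 1 - β₂ + β₂ * x), ?_, ?_⟩
      · intro x hx
        rcases hΛ hx with ⟨y, hy, rfl⟩ | ⟨y, hy, rfl⟩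
        · obtain ⟨a, ha, hya⟩ := mem_iUnion₂.1 (ht hy)
          refine mem_iUnion₂.2 ⟨β₁ * a, Finset.mem_union_left _ (Finset.mem_image_of_mem _ ha), ?_⟩
          rw [Metric.mem_closedBall, Real.dist_eq, le_div_iff₀ h10] at hya
          rw [Metric.mem_closedBall, Real.dist_eq, ← mul_sub, abs_mul, abs_of_pos h10]
          linarith
        · obtain ⟨a, ha, hya⟩ := mem_iUnion₂.1 (hu hy)
          refine mem_iUnion₂.2 ⟨1 - β₂ + β₂ * a,
            Finset.mem_union_right _ (Finset.mem_image_of_mem _ ha), ?_⟩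
          rw [Metric.mem_closedBall, Real.dist_eq, le_div_iff₀ h20] at hya
          rw [Metric.mem_closedBall, Real.dist_eq, add_sub_add_left_eq_sub, ← mul_sub, abs_mul,
            abs_of_pos h20]
          linarith
      · have hscale' : ∀ β, 0 < β → K * (r / β) ^ (-D) = K * r ^ (-D) * β ^ D := by
          intro β hβ
          rw [Real.div_rpow hr0.le hβ.le, Real.rpow_neg hβ.le, div_inv_eq_mul, mul_assoc]
        rw [hscale' _ h10] at htc
        rw [hscale' _ h20] at huc
        calc ((t.image (fun x => β₁ * x) ∪ u.image (fun x => 1 - β₂ + β₂ * x)).card : ℝ)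
            ≤ ((t.card + u.card : ℕ) : ℝ) := by
              exact_mod_cast (Finset.card_union_le _ _).trans
                (add_le_add Finset.card_image_le Finset.card_image_le)
          _ ≤ K * r ^ (-D) * β₁ ^ D + K * r ^ (-D) * β₂ ^ D := by push_cast; linarith
          _ = K * r ^ (-D) := by rw [← mul_add, hD, mul_one]
  refine ⟨K, fun r hr => ?_⟩
  obtain ⟨k, hk⟩ := exists_pow_lt_of_lt_one hr.1 hM1
  exact main k r hk.le (hr.2.trans (by rwa [one_le_div hm0]))

theorem hasCoverBound_Icc : ∃ K, HasCoverBound (Icc (0 : ℝ) 1) 1 K := by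
  refine hasCoverBound_of_subset_union (β₁ := 1 / 2) (β₂ := 1 / 2) (by norm_num) (by norm_num)
    zero_le_one (by norm_num) subset_rfl fun x hx => ?_
  rcases le_total x (1 / 2) with h | h
  · exact Or.inl ⟨2 * x, ⟨by linarith [hx.1], by linarith⟩, by ring⟩
  · exact Or.inr ⟨2 * x - 1, ⟨by linarith, by linarith [hx.2]⟩, by ring⟩

theorem attractor_subset_Icc {β₁ β₂ : ℝ} (hβ₁ : β₁ ∈ Ioo (0 : ℝ) 1)
    (hβ₂ : β₂ ∈ Ioo (0 : ℝ) 1) {Λ : Set ℝ} (hΛc : IsCompact Λ) (hΛne : Λ.Nonempty)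
    (hΛ : Λ ⊆ (fun x => β₁ * x) '' Λ ∪ (fun x => 1 - β₂ + β₂ * x) '' Λ) : Λ ⊆ Icc 0 1 := by
  obtain ⟨h10, h11⟩ := hβ₁
  obtain ⟨h20, h21⟩ := hβ₂
  obtain ⟨a, ha, hmin⟩ := hΛc.exists_isLeast hΛne
  obtain ⟨c, hc, hmax⟩ := hΛc.exists_isGreatest hΛne
  intro x hx
  constructor
  · refine le_trans ?_ (hmin hx)
    rcases hΛ ha with ⟨y, hy, h⟩ | ⟨y, hy, h⟩ <;> have := hmin hy <;> simp only at h <;> nlinarith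
  · refine (hmax hx).trans ?_
    rcases hΛ hc with ⟨y, hy, h⟩ | ⟨y, hy, h⟩ <;> have := hmax hy <;> simp only at h <;> nlinarith

theorem exists_coding {β₁ β₂ : ℝ} (hβ₁ : β₁ ∈ Ioo (0 : ℝ) 1) (hβ₂ : β₂ ∈ Ioo (0 : ℝ) 1)
    {Λ : Set ℝ} (hΛc : IsClosed Λ) (hΛne : Λ.Nonempty) (hΛI : Λ ⊆ Icc 0 1)
    (h₁ : ∀ x ∈ Λ, β₁ * x ∈ Λ) (h₂ : ∀ x ∈ Λ, 1 - β₂ + β₂ * x ∈ Λ) (p : ℝ) :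
    ∃ φ : ℝ → ℝ, (∀ t, φ t ∈ Λ) ∧
      ∀ t, φ t = if t ≤ p then β₁ * φ (t / p) else 1 - β₂ + β₂ * φ ((t - p) / (1 - p)) := by
  obtain ⟨h10, h11⟩ := hβ₁
  obtain ⟨h20, h21⟩ := hβ₂
  obtain ⟨x₀, hx₀⟩ := hΛne
  let F : (ℝ → ℝ) → ℝ → ℝ := fun φ t =>
    if t ≤ p then β₁ * φ (t / p) else 1 - β₂ + β₂ * φ ((t - p) / (1 - p))
  let φ : ℕ → ℝ → ℝ := fun n => F^[n] fun _ => x₀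
  have hsucc : ∀ n, φ (n + 1) = F (φ n) := fun n => Function.iterate_succ_apply' _ _ _
  have hmem : ∀ n t, φ n t ∈ Λ := by
    intro n
    induction n with
    | zero => exact fun _ => hx₀
    | succ n ih =>
      intro t
      rw [hsucc]
      by_cases h : t ≤ p
      · simpa only [F, if_pos h] using h₁ _ (ih _)
      · simpa only [F, if_neg h] using h₂ _ (ih _)
  set M := max β₁ β₂ with hM
  have hM0 : 0 < M := lt_max_of_lt_left h10
  have hdist : ∀ n t, dist (φ n t) (φ (n + 1) t) ≤ 1 * M ^ n := by
    intro n
    induction n with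
    | zero =>
      intro t
      have ha := hΛI (hmem 0 t)
      have hc := hΛI (hmem 1 t)
      rw [Real.dist_eq, abs_le]
      constructor <;> simp only [pow_zero, zero_add] <;> linarith [ha.1, ha.2, hc.1, hc.2]
    | succ n ih =>
      intro t
      rw [hsucc (n + 1), hsucc n]
      by_cases h : t ≤ p
      · simp only [F, if_pos h]
        rw [Real.dist_eq, ← mul_sub, abs_mul, abs_of_pos h10, ← Real.dist_eq]
        calc β₁ * dist (φ n (t / p)) (F (φ n) (t / p)) ≤ M * (1 * M ^ n) := by
              gcongr
              · exact le_max_left _ _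
              · rw [← hsucc]; exact ih _
          _ = _ := by ring
      · simp only [F, if_neg h]
        rw [Real.dist_eq, add_sub_add_left_eq_sub, ← mul_sub, abs_mul, abs_of_pos h20,
          ← Real.dist_eq]
        calc β₂ * dist (φ n ((t - p) / (1 - p))) (F (φ n) ((t - p) / (1 - p)))
            ≤ M * (1 * M ^ n) := by
              gcongr
              · exact le_max_right _ _
              · rw [← hsucc]; exact ih _
          _ = _ := by ring
  have hlim : ∀ t, ∃ y, Tendsto (fun n => φ n t) atTop (nhds y) := fun t =>
    cauchySeq_tendsto_of_complete
      (cauchySeq_of_le_geometric M 1 (max_lt h11 h21) fun n => hdist n t)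
  choose ψ hψ using hlim
  refine ⟨ψ, fun t => hΛc.mem_of_tendsto (hψ t) (Eventually.of_forall fun n => hmem n t), ?_⟩
  intro t
  refine tendsto_nhds_unique ((tendsto_add_atTop_iff_nat 1).2 (hψ t)) ?_
  simp only [hsucc]
  by_cases h : t ≤ p
  · simpa only [F, if_pos h] using (hψ _).const_mul β₁
  · simpa only [F, if_neg h] using ((hψ _).const_mul β₂).const_add (1 - β₂)

theorem exists_coding_antiholder {β₁ β₂ : ℝ} (hβ₁ : β₁ ∈ Ioo (0 : ℝ) 1)
    (hβ₂ : β₂ ∈ Ioo (0 : ℝ) 1) (hsum : β₁ + β₂ < 1) {D : ℝ} (hD0 : 0 < D)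
    (hD : β₁ ^ D + β₂ ^ D = 1) {Λ : Set ℝ} (hΛc : IsClosed Λ) (hΛne : Λ.Nonempty)
    (hΛI : Λ ⊆ Icc 0 1) (h₁ : ∀ x ∈ Λ, β₁ * x ∈ Λ) (h₂ : ∀ x ∈ Λ, 1 - β₂ + β₂ * x ∈ Λ) :
    ∃ φ : ℝ → ℝ, (∀ t, φ t ∈ Λ) ∧ ∃ C : ℝ, 0 < C ∧ ∀ t ∈ Icc (0 : ℝ) 1, ∀ u ∈ Icc (0 : ℝ) 1,
      |t - u| ≤ C * |φ t - φ u| ^ D := by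
  obtain ⟨φ, hφΛ, hφ⟩ := exists_coding hβ₁ hβ₂ hΛc hΛne hΛI h₁ h₂ (β₁ ^ D)
  obtain ⟨h10, h11⟩ := hβ₁
  obtain ⟨h20, h21⟩ := hβ₂
  refine ⟨φ, hφΛ, ?_⟩
  have hp0 : 0 < β₁ ^ D := by positivity
  have hq0 : 0 < β₂ ^ D := by positivity
  have hp1 : β₁ ^ D < 1 := by linarith
  have hqp : 1 - β₁ ^ D = β₂ ^ D := by linarith
  have hq1 : β₂ ^ D < 1 := by linarith
  rw [hqp] at hφ
  set p := β₁ ^ D with hpdef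
  set q := β₂ ^ D with hqdef
  set gap := 1 - β₁ - β₂ with hgap
  have hgap0 : 0 < gap := by simp only [hgap]; linarith
  have hgapD : 0 < gap ^ D := by positivity
  set C := 1 / gap ^ D with hC
  have hC0 : 0 < C := by positivity
  set M := max p q with hM
  have hM0 : 0 < M := lt_max_of_lt_left hp0
  have hφI : ∀ t, φ t ∈ Icc (0 : ℝ) 1 := fun t => hΛI (hφΛ t)
  have hfar : ∀ t ∈ Icc (0 : ℝ) 1, ∀ u ∈ Icc (0 : ℝ) 1, t ≤ p → p < u →
      |t - u| ≤ C * |φ t - φ u| ^ D := by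
    intro t ht u hu htp hpu
    have hd : gap ≤ |φ t - φ u| := by
      rw [hφ t, hφ u, if_pos htp, if_neg (not_le.2 hpu), abs_sub_comm]
      refine le_trans ?_ (le_abs_self _)
      have ha := (hφI (t / p)).2
      have hc := (hφI ((u - p) / q)).1
      have := mul_le_mul_of_nonneg_left ha h10.le
      have := mul_nonneg h20.le hc
      simp only [hgap]; linarith
    have h1 : |t - u| ≤ 1 := by
      rw [abs_le]; constructor <;> linarith [ht.1, ht.2, hu.1, hu.2]
    refine h1.trans ?_
    rw [hC, one_div_mul_eq_div, one_le_div hgapD]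
    exact Real.rpow_le_rpow hgap0.le hd hD0.le
  have main : ∀ n : ℕ, ∀ t ∈ Icc (0 : ℝ) 1, ∀ u ∈ Icc (0 : ℝ) 1,
      |t - u| ≤ C * |φ t - φ u| ^ D + M ^ n := by
    intro n
    induction n with
    | zero =>
      intro t ht u hu
      have h1 : |t - u| ≤ 1 := by
        rw [abs_le]; constructor <;> linarith [ht.1, ht.2, hu.1, hu.2]
      have : 0 ≤ C * |φ t - φ u| ^ D := by positivity
      simp only [pow_zero]; linarith
    | succ n ih =>
      intro t ht u hu
      have hMn : 0 < M ^ (n + 1) := by positivity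
      rcases le_or_gt t p with htp | htp <;> rcases le_or_gt u p with hup | hup
      · have key := ih (t / p) ⟨by have := ht.1; positivity, by rwa [div_le_one hp0]⟩ (u / p)
          ⟨by have := hu.1; positivity, by rwa [div_le_one hp0]⟩
        rw [hφ t, hφ u, if_pos htp, if_pos hup, ← mul_sub, abs_mul, abs_of_pos h10,
          Real.mul_rpow h10.le (abs_nonneg _), ← hpdef]
        rw [← sub_div, abs_div, abs_of_pos hp0, div_le_iff₀ hp0] at key
        calc |t - u| ≤ _ := key
          _ = C * (p * |φ (t / p) - φ (u / p)| ^ D) + M ^ n * p := by ring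
          _ ≤ _ := by rw [pow_succ]; gcongr; exact le_max_left _ _
      · linarith [hfar t ht u hu htp hup]
      · rw [abs_sub_comm t u, abs_sub_comm (φ t)]
        linarith [hfar u hu t ht hup htp]
      · have hmem : ∀ s ∈ Icc (0 : ℝ) 1, p < s → (s - p) / q ∈ Icc (0 : ℝ) 1 := fun s hs hps =>
          ⟨div_nonneg (by linarith) hq0.le, by rw [div_le_one hq0]; linarith [hs.2]⟩
        have key := ih _ (hmem t ht htp) _ (hmem u hu hup)
        rw [hφ t, hφ u, if_neg (not_le.2 htp), if_neg (not_le.2 hup), add_sub_add_left_eq_sub,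
          ← mul_sub, abs_mul, abs_of_pos h20, Real.mul_rpow h20.le (abs_nonneg _), ← hqdef]
        rw [← sub_div, abs_div, abs_of_pos hq0, div_le_iff₀ hq0, sub_sub_sub_cancel_right] at key
        calc |t - u| ≤ _ := key
          _ = C * (q * |φ ((t - p) / q) - φ ((u - p) / q)| ^ D) + M ^ n * q := by ring
          _ ≤ _ := by rw [pow_succ]; gcongr; exact le_max_right _ _
  refine ⟨C, hC0, fun t ht u hu => ?_⟩
  refine ge_of_tendsto' (x := atTop) (f := fun n : ℕ => C * |φ t - φ u| ^ D + M ^ n) ?_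
    fun n => main n t ht u hu
  simpa using (tendsto_pow_atTop_nhds_zero_of_lt_one hM0.le (max_lt hp1 hq1)).const_add
    (C * |φ t - φ u| ^ D)

open MeasureTheory in
theorem ofReal_le_dimH_of_forall_measure_preimage_le {X Y : Type*} [MeasurableSpace X]
    [EMetricSpace Y] (μ : Measure X) (Φ : X → Y) {s : ℝ} (hs : 0 ≤ s) {C : ENNReal}
    (hC : C ≠ ⊤) (h : ∀ A : Set Y, μ (Φ ⁻¹' A) ≤ C * Metric.ediam A ^ s) {E : Set Y}
    (hE : μ (Φ ⁻¹' E) ≠ 0) : ENNReal.ofReal s ≤ dimH E := by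
  borelize Y
  refine le_dimH_of_hausdorffMeasure_ne_zero ?_
  rw [Real.coe_toNNReal s hs, Measure.hausdorffMeasure, ← OuterMeasure.coe_mkMetric]
  have hle : OuterMeasure.map Φ (C⁻¹ • μ).toOuterMeasure ≤ OuterMeasure.mkMetric (· ^ s) := by
    refine OuterMeasure.le_mkMetric _ _ 1 one_pos fun A _ => ?_
    rw [OuterMeasure.map_apply, Measure.coe_toOuterMeasure, Measure.smul_apply, smul_eq_mul,
      mul_comm, ← div_eq_mul_inv]
    exact ENNReal.div_le_of_le_mul' (h A)
  have hpos : OuterMeasure.map Φ (C⁻¹ • μ).toOuterMeasure E ≠ 0 := by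
    rw [OuterMeasure.map_apply, Measure.coe_toOuterMeasure, Measure.smul_apply, smul_eq_mul]
    exact mul_ne_zero (ENNReal.inv_ne_zero.2 hC) hE
  exact fun h0 => hpos (le_antisymm ((hle E).trans h0.le) zero_le)

/-- The uniform measure on `(0, 1]`. -/
def unitMeasure : MeasureTheory.Measure ℝ := MeasureTheory.volume.restrict (Ioc 0 1)

instance : MeasureTheory.IsProbabilityMeasure unitMeasure :=
  ⟨by simp [unitMeasure]⟩

theorem ae_unitMeasure_mem : ∀ᵐ x ∂unitMeasure, x ∈ Ioc (0 : ℝ) 1 :=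
  MeasureTheory.ae_restrict_mem measurableSet_Ioc

/-- Points `(t, y, u, z)` of the unit cube, with the coordinates grouped in pairs, and their
images in `(ℝ × ℝ) × (ℝ × ℝ)` under a coding map `φ` applied to `t` and `u`. -/
def pairCoding (φ : ℝ → ℝ) : (ℝ × ℝ) × (ℝ × ℝ) → (ℝ × ℝ) × (ℝ × ℝ) :=
  Prod.map (Prod.map φ id) (Prod.map φ id)

open MeasureTheory in
theorem measure_preimage_pairCoding_le {φ : ℝ → ℝ} {C D : ℝ} (hC : 0 ≤ C) (hD : 0 ≤ D)
    (hφ : ∀ t ∈ Icc (0 : ℝ) 1, ∀ u ∈ Icc (0 : ℝ) 1, |t - u| ≤ C * |φ t - φ u| ^ D)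
    (A : Set ((ℝ × ℝ) × (ℝ × ℝ))) :
    (unitMeasure.prod unitMeasure).prod (unitMeasure.prod unitMeasure) (pairCoding φ ⁻¹' A) ≤
      ENNReal.ofReal C ^ 2 * Metric.ediam A ^ (2 * (D + 1)) := by
  set r := Metric.ediam A with hr
  set I : Set ℝ := Ioc 0 1
  set P := pairCoding φ ⁻¹' A ∩ (I ×ˢ I) ×ˢ (I ×ˢ I) with hP
  have hcoord : ∀ f : (ℝ × ℝ) × (ℝ × ℝ) → ℝ, (∀ v w, edist (f v) (f w) ≤ edist v w) →
      ∀ v ∈ P, ∀ w ∈ P, edist (f (pairCoding φ v)) (f (pairCoding φ w)) ≤ r :=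
    fun f hf v hv w hw => (hf _ _).trans (Metric.edist_le_ediam_of_mem hv.1 hw.1)
  have hant : ∀ t ∈ I, ∀ u ∈ I, edist (φ t) (φ u) ≤ r → edist t u ≤ ENNReal.ofReal C * r ^ D := by
    intro t ht u hu h
    calc edist t u = ENNReal.ofReal |t - u| := by rw [edist_dist, Real.dist_eq]
      _ ≤ ENNReal.ofReal (C * |φ t - φ u| ^ D) :=
          ENNReal.ofReal_le_ofReal (hφ t (Ioc_subset_Icc_self ht) u (Ioc_subset_Icc_self hu))
      _ = ENNReal.ofReal C * edist (φ t) (φ u) ^ D := by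
          rw [ENNReal.ofReal_mul hC, edist_dist, Real.dist_eq,
            ENNReal.ofReal_rpow_of_nonneg (abs_nonneg _) hD]
      _ ≤ _ := by gcongr
  have hle : ∀ S : Set ℝ, ∀ d, (∀ x ∈ S, ∀ y ∈ S, edist x y ≤ d) → unitMeasure S ≤ d :=
    fun S d hS => (Measure.restrict_apply_le _ _).trans
      ((Real.volume_le_diam S).trans (Metric.ediam_le hS))
  have h1 : unitMeasure ((fun v => v.1.1) '' P) ≤ ENNReal.ofReal C * r ^ D := by
    refine hle _ _ ?_
    rintro _ ⟨v, hv, rfl⟩ _ ⟨w, hw, rfl⟩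
    exact hant _ hv.2.1.1 _ hw.2.1.1 (hcoord (fun v => v.1.1)
      (fun v w => (le_max_left _ _).trans (le_max_left _ _)) v hv w hw)
  have h2 : unitMeasure ((fun v => v.1.2) '' P) ≤ r := by
    refine hle _ _ ?_
    rintro _ ⟨v, hv, rfl⟩ _ ⟨w, hw, rfl⟩
    exact hcoord (fun v => v.1.2)
      (fun v w => (le_max_right _ _).trans (le_max_left _ _)) v hv w hw
  have h3 : unitMeasure ((fun v => v.2.1) '' P) ≤ ENNReal.ofReal C * r ^ D := by
    refine hle _ _ ?_
    rintro _ ⟨v, hv, rfl⟩ _ ⟨w, hw, rfl⟩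
    exact hant _ hv.2.2.1 _ hw.2.2.1 (hcoord (fun v => v.2.1)
      (fun v w => (le_max_left _ _).trans (le_max_right _ _)) v hv w hw)
  have h4 : unitMeasure ((fun v => v.2.2) '' P) ≤ r := by
    refine hle _ _ ?_
    rintro _ ⟨v, hv, rfl⟩ _ ⟨w, hw, rfl⟩
    exact hcoord (fun v => v.2.2)
      (fun v w => (le_max_right _ _).trans (le_max_right _ _)) v hv w hw
  have hae : ∀ᵐ v ∂(unitMeasure.prod unitMeasure).prod (unitMeasure.prod unitMeasure),
      v ∈ (I ×ˢ I) ×ˢ (I ×ˢ I) := by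
    simp only [unitMeasure, Measure.prod_restrict]
    exact ae_restrict_mem (((measurableSet_Ioc.prod measurableSet_Ioc)).prod
      (measurableSet_Ioc.prod measurableSet_Ioc))
  calc (unitMeasure.prod unitMeasure).prod (unitMeasure.prod unitMeasure) (pairCoding φ ⁻¹' A)
      ≤ (unitMeasure.prod unitMeasure).prod (unitMeasure.prod unitMeasure)
        ((((fun v => v.1.1) '' P) ×ˢ ((fun v => v.1.2) '' P)) ×ˢ
          (((fun v => v.2.1) '' P) ×ˢ ((fun v => v.2.2) '' P))) := by
        refine measure_mono_ae ?_
        filter_upwards [hae] with v hv hvA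
        have hvP : v ∈ P := ⟨hvA, hv⟩
        exact ⟨⟨mem_image_of_mem _ hvP, mem_image_of_mem _ hvP⟩,
          ⟨mem_image_of_mem _ hvP, mem_image_of_mem _ hvP⟩⟩
    _ ≤ ((ENNReal.ofReal C * r ^ D) * r) * ((ENNReal.ofReal C * r ^ D) * r) := by
        simp only [Measure.prod_prod]
        gcongr
    _ = ENNReal.ofReal C ^ 2 * ((r ^ D * r) * (r ^ D * r)) := by ring
    _ = _ := by
        have h5 : r ^ D * r = r ^ (D + 1) := by
          rw [ENNReal.rpow_add_of_nonneg _ _ hD zero_le_one, ENNReal.rpow_one]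
        rw [h5, ← ENNReal.rpow_add_of_nonneg _ _ (by positivity) (by positivity), two_mul]

/-- The doubling map, in the convention for which `(0, 1]` is invariant. -/
def doubling (y : ℝ) : ℝ := if y ≤ 1 / 2 then 2 * y else 2 * y - 1

theorem doubling_mem {y : ℝ} (hy : y ∈ Ioc (0 : ℝ) 1) : doubling y ∈ Ioc (0 : ℝ) 1 := by
  obtain ⟨h0, h1⟩ := hy
  unfold doubling
  split_ifs with h
  · exact ⟨by linarith, by linarith⟩
  · exact ⟨by linarith, by linarith⟩

theorem measurable_doubling : Measurable doubling :=
  Measurable.ite measurableSet_Iic (by fun_prop) (by fun_prop)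

open MeasureTheory in
theorem measurePreserving_doubling : MeasurePreserving doubling unitMeasure unitMeasure := by
  refine ⟨measurable_doubling, ?_⟩
  have : IsProbabilityMeasure (unitMeasure.map doubling) :=
    Measure.isProbabilityMeasure_map measurable_doubling.aemeasurable
  refine Measure.eq_of_le_of_measure_univ_eq (Measure.le_iff.2 fun A hA => ?_) (by simp)
  have hsub : doubling ⁻¹' A ∩ Ioc 0 1 ⊆ ((2 : ℝ) * ·) ⁻¹' (A ∩ Ioc 0 1) ∪
      (· + (-1 / 2 : ℝ)) ⁻¹' (((2 : ℝ) * ·) ⁻¹' (A ∩ Ioc 0 1)) := by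
    rintro y ⟨hyA, hy⟩
    have hd := doubling_mem hy
    by_cases h : y ≤ 1 / 2
    · left
      simp only [mem_preimage, doubling, if_pos h] at hyA hd
      exact ⟨hyA, hd⟩
    · right
      simp only [mem_preimage, doubling, if_neg h] at hyA hd
      have he : 2 * (y + -1 / 2) = 2 * y - 1 := by ring
      simp only [mem_preimage, he]
      exact ⟨hyA, hd⟩
  rw [Measure.map_apply measurable_doubling hA, unitMeasure,
    Measure.restrict_apply' measurableSet_Ioc, Measure.restrict_apply' measurableSet_Ioc]
  refine (measure_mono hsub).trans ((measure_union_le _ _).trans ?_)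
  rw [measure_preimage_add_right, Real.volume_preimage_mul_left two_ne_zero, ← add_mul,
    ← ENNReal.ofReal_add (by positivity) (by positivity), abs_of_pos (by norm_num)]
  norm_num

open MeasureTheory in
/-- If the part of `Q` that a fixed iterate sends into `B` is always at least proportional to `B`,
then almost every orbit visits `Q` infinitely often. -/
theorem ae_frequently_mem_of_forall_measure_le {X : Type*} [MeasurableSpace X] {μ : Measure X}
    [IsFiniteMeasure μ] {f : X → X} (hf : MeasurePreserving f μ μ) {Q : Set X}
    (hQ : MeasurableSet Q) (m : ℕ) {c : ENNReal} (hc : c ≠ 0)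
    (h : ∀ B, MeasurableSet B → c * μ B ≤ μ (Q ∩ f^[m] ⁻¹' B)) :
    ∀ᵐ x ∂μ, ∃ᶠ n in atTop, f^[n] x ∈ Q := by
  set B : Set X := ⋂ n, f^[n] ⁻¹' Qᶜ with hB
  have hBm : MeasurableSet B := MeasurableSet.iInter fun n => (hf.iterate n).measurable hQ.compl
  have hsub : B ⊆ f^[m] ⁻¹' B \ (Q ∩ f^[m] ⁻¹' B) := by
    intro x hx
    rw [hB, mem_iInter] at hx
    refine ⟨mem_iInter.2 fun n => ?_, fun hxQ => hx 0 hxQ.1⟩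
    have := hx (n + m)
    rwa [mem_preimage, Function.iterate_add_apply] at this
  have hB0 : μ B = 0 := by
    have hpre : μ (f^[m] ⁻¹' B) = μ B := (hf.iterate m).measure_preimage hBm.nullMeasurableSet
    have h1 := measure_mono (μ := μ) hsub
    rw [measure_sdiff inter_subset_right
      (hQ.inter ((hf.iterate m).measurable hBm)).nullMeasurableSet (measure_ne_top _ _), hpre] at h1
    have h2 : μ (Q ∩ f^[m] ⁻¹' B) ≤ μ B := (measure_mono inter_subset_right).trans hpre.le
    by_contra hne
    have hpos : 0 < μ (Q ∩ f^[m] ⁻¹' B) :=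
      lt_of_lt_of_le (pos_iff_ne_zero.2 (mul_ne_zero hc hne)) (h B hBm)
    exact absurd h1 (not_le.2 (ENNReal.sub_lt_self (measure_ne_top _ _) hne hpos.ne'))
  have hvisit : ∀ᵐ x ∂μ, ∃ n, f^[n] x ∈ Q := by
    filter_upwards [measure_eq_zero_iff_ae_notMem.1 hB0] with x hx
    simpa [hB] using hx
  have hall : ∀ᵐ x ∂μ, ∀ N, ∃ n, f^[n] (f^[N] x) ∈ Q :=
    ae_all_iff.2 fun N => (hf.iterate N).quasiMeasurePreserving.ae hvisit
  filter_upwards [hall] with x hx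
  refine frequently_atTop.2 fun N => ?_
  obtain ⟨n, hn⟩ := hx N
  exact ⟨n + N, Nat.le_add_left _ _, by rwa [Function.iterate_add_apply]⟩

open MeasureTheory in
theorem ae_frequently_doubling_mem {Q : Set (ℝ × ℝ)} (hQ : MeasurableSet Q) (m : ℕ) {r : ℝ}
    (hr : r ≠ 0) (v : ℝ × ℝ)
    (hbr : ∀ z ∈ Ioc (0 : ℝ) 1 ×ˢ Ioc (0 : ℝ) 1, v + r • z ∈ Ioc (0 : ℝ) 1 ×ˢ Ioc (0 : ℝ) 1 ∧
      v + r • z ∈ Q ∧ (Prod.map doubling doubling)^[m] (v + r • z) = z) :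
    ∀ᵐ z ∂unitMeasure.prod unitMeasure,
      ∃ᶠ n in atTop, (Prod.map doubling doubling)^[n] z ∈ Q := by
  have hmeas : MeasurableSet (Ioc (0 : ℝ) 1 ×ˢ Ioc (0 : ℝ) 1) :=
    measurableSet_Ioc.prod measurableSet_Ioc
  refine ae_frequently_mem_of_forall_measure_le
    (measurePreserving_doubling.prod measurePreserving_doubling) hQ m
    (c := ENNReal.ofReal |r ^ Module.finrank ℝ (ℝ × ℝ)|) ?_ fun B _ => ?_
  · exact (ENNReal.ofReal_pos.2 (abs_pos.2 (pow_ne_zero _ hr))).ne'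
  · rw [unitMeasure, Measure.prod_restrict, Measure.restrict_apply' hmeas,
      Measure.restrict_apply' hmeas, ← Measure.volume_eq_prod, ← Measure.addHaar_smul,
      ← measure_vadd volume v]
    refine measure_mono ?_
    rintro _ ⟨_, ⟨z, hz, rfl⟩, rfl⟩
    obtain ⟨h1, h2, h3⟩ := hbr z hz.2
    refine ⟨⟨h2, ?_⟩, h1⟩
    change (Prod.map doubling doubling)^[m] (v + r • z) ∈ B
    rw [h3]
    exact hz.1

theorem doubling_iterate_of_le {y : ℝ} (k : ℕ) (hy : 2 ^ k * y ≤ 1) :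
    doubling^[k] y = 2 ^ k * y := by
  induction k with
  | zero => simp
  | succ k ih =>
    have h : 2 ^ k * y ≤ 1 / 2 := by rw [pow_succ] at hy; linarith
    rw [Function.iterate_succ_apply', ih (by linarith), doubling, if_pos h]
    ring

theorem ae_frequently_doubling_small (k : ℕ) : ∀ᵐ z ∂unitMeasure.prod unitMeasure,
    ∃ᶠ n in atTop, (Prod.map doubling doubling)^[n] z ∈ Iic ((1 / 2 : ℝ) ^ k) ×ˢ
      Iic ((1 / 2 : ℝ) ^ k) := by
  have hpos : (0 : ℝ) < (1 / 2) ^ k := by positivity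
  have hle : ((1 : ℝ) / 2) ^ k ≤ 1 := pow_le_one₀ (by norm_num) (by norm_num)
  have hmul : (2 : ℝ) ^ k * (1 / 2) ^ k = 1 := by rw [← mul_pow]; norm_num
  have hsmall : ∀ y ∈ Ioc (0 : ℝ) 1, (1 / 2 : ℝ) ^ k * y ∈ Ioc (0 : ℝ) 1 ∧
      (1 / 2 : ℝ) ^ k * y ≤ (1 / 2) ^ k ∧ doubling^[k] ((1 / 2 : ℝ) ^ k * y) = y := by
    intro y hy
    have h1 : (1 / 2 : ℝ) ^ k * y ≤ (1 / 2) ^ k := mul_le_of_le_one_right hpos.le hy.2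
    have h2 : (2 : ℝ) ^ k * ((1 / 2) ^ k * y) = y := by rw [← mul_assoc, hmul, one_mul]
    refine ⟨⟨mul_pos hpos hy.1, h1.trans hle⟩, h1, ?_⟩
    rw [doubling_iterate_of_le k (h2.trans_le hy.2), h2]
  refine ae_frequently_doubling_mem (measurableSet_Iic.prod measurableSet_Iic) k hpos.ne' 0
    fun z hz => ?_
  obtain ⟨a1, a2, a3⟩ := hsmall z.1 hz.1
  obtain ⟨c1, c2, c3⟩ := hsmall z.2 hz.2
  rw [zero_add, Prod.map_iterate]
  exact ⟨⟨a1, c1⟩, ⟨a2, c2⟩, Prod.ext a3 c3⟩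

theorem ae_frequently_doubling_far : ∀ᵐ z ∂unitMeasure.prod unitMeasure,
    ∃ᶠ n in atTop, (Prod.map doubling doubling)^[n] z ∈ Iic (1 / 4 : ℝ) ×ˢ Ici (3 / 4 : ℝ) := by
  refine ae_frequently_doubling_mem (measurableSet_Iic.prod measurableSet_Ici) 2
    (r := 1 / 4) (by norm_num) (0, 3 / 4) ?_
  rintro ⟨y, z⟩ ⟨⟨hy0, hy1⟩, hz0, hz1⟩
  simp only at hy0 hy1 hz0 hz1
  have hv : ((0, 3 / 4) : ℝ × ℝ) + (1 / 4 : ℝ) • (y, z) = (y / 4, (3 + z) / 4) := by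
    ext <;> simp <;> ring
  rw [hv]
  refine ⟨⟨⟨by simp only; linarith, by simp only; linarith⟩,
    by simp only; linarith, by simp only; linarith⟩,
    ⟨by simp only [mem_Iic]; linarith, by simp only [mem_Ici]; linarith⟩, ?_⟩
  rw [Prod.map_iterate]
  refine Prod.ext ?_ ?_
  · simp only [Prod.map_apply]
    rw [doubling_iterate_of_le 2 (by linarith)]
    ring
  · simp only [Prod.map_apply, Function.iterate_succ_apply, Function.iterate_zero_apply]
    have h1 : doubling ((3 + z) / 4) = (1 + z) / 2 := by
      rw [doubling, if_neg (by linarith)]; ring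
    rw [h1, doubling, if_neg (by linarith)]
    ring

theorem mem_liYorkePairs_of_frequently {E : Type*} [PseudoMetricSpace E] {f : E → E} {S : Set E}
    {p : E × E} (h₁ : p.1 ∈ S) (h₂ : p.2 ∈ S) {R δ : ℝ} (hδ : 0 < δ)
    (hR : ∀ n, dist (f^[n] p.1) (f^[n] p.2) ≤ R)
    (hsmall : ∀ ε > 0, ∃ᶠ n in atTop, dist (f^[n] p.1) (f^[n] p.2) ≤ ε)
    (hfar : ∃ᶠ n in atTop, δ ≤ dist (f^[n] p.1) (f^[n] p.2)) : p ∈ liYorkePairs f S := by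
  have hb : IsBoundedUnder (· ≤ ·) atTop fun n : ℕ => dist (f^[n] p.1) (f^[n] p.2) :=
    isBoundedUnder_of ⟨R, hR⟩
  have hb' : IsBoundedUnder (· ≥ ·) atTop fun n : ℕ => dist (f^[n] p.1) (f^[n] p.2) :=
    isBoundedUnder_of ⟨0, fun _ => dist_nonneg⟩
  refine ⟨h₁, h₂, le_antisymm (le_of_forall_pos_le_add fun ε hε => ?_) ?_, ?_⟩
  · rw [zero_add]
    exact liminf_le_of_frequently_le (hsmall ε hε) hb'
  · exact le_liminf_of_le hb.isCoboundedUnder_ge (Eventually.of_forall fun _ => dist_nonneg)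
  · exact hδ.trans_le (le_limsup_of_frequently_le hfar hb)

section Baker

variable {β₁ β₂ : ℝ} {b : ℝ × ℝ → ℝ × ℝ}

theorem baker_iterate_mem
    (hb : ∀ p : ℝ × ℝ,
      b p = if p.2 ≤ 1 / 2 then (β₁ * p.1, 2 * p.2) else (1 - β₂ + β₂ * p.1, 2 * p.2 - 1))
    {Λ : Set ℝ} (h₁ : ∀ x ∈ Λ, β₁ * x ∈ Λ) (h₂ : ∀ x ∈ Λ, 1 - β₂ + β₂ * x ∈ Λ) {p : ℝ × ℝ}
    (hp : p ∈ Λ ×ˢ Ioc (0 : ℝ) 1) (n : ℕ) :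
    b^[n] p ∈ Λ ×ˢ Ioc (0 : ℝ) 1 ∧ (b^[n] p).2 = doubling^[n] p.2 := by
  have hb2 : ∀ q, (b q).2 = doubling q.2 := fun q => by
    rw [hb, doubling]; split_ifs <;> rfl
  have hmaps : MapsTo b (Λ ×ˢ Ioc (0 : ℝ) 1) (Λ ×ˢ Ioc (0 : ℝ) 1) := by
    rintro q ⟨hq1, hq2⟩
    refine ⟨?_, by rw [hb2]; exact doubling_mem hq2⟩
    rw [hb]
    split_ifs
    · exact h₁ _ hq1
    · exact h₂ _ hq1
  exact ⟨hmaps.iterate n hp, Function.Semiconj.iterate_right (f := Prod.snd) hb2 n p⟩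

theorem baker_iterate_of_le
    (hb : ∀ p : ℝ × ℝ,
      b p = if p.2 ≤ 1 / 2 then (β₁ * p.1, 2 * p.2) else (1 - β₂ + β₂ * p.1, 2 * p.2 - 1))
    {p : ℝ × ℝ} (k : ℕ) (hp : 2 ^ k * p.2 ≤ 1) :
    b^[k] p = (β₁ ^ k * p.1, 2 ^ k * p.2) := by
  induction k with
  | zero => simp
  | succ k ih =>
    have h : 2 ^ k * p.2 ≤ 1 / 2 := by rw [pow_succ] at hp; linarith
    rw [Function.iterate_succ_apply', ih (by linarith), hb, if_pos h]
    ext <;> simp only <;> ring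

theorem dist_baker_iterate_le
    (hb : ∀ p : ℝ × ℝ,
      b p = if p.2 ≤ 1 / 2 then (β₁ * p.1, 2 * p.2) else (1 - β₂ + β₂ * p.1, 2 * p.2 - 1))
    (hβ₁ : 0 < β₁) {p q : ℝ × ℝ} (hp : p ∈ Icc (0 : ℝ) 1 ×ˢ Ioc (0 : ℝ) 1)
    (hq : q ∈ Icc (0 : ℝ) 1 ×ˢ Ioc (0 : ℝ) 1) (k : ℕ) (hpk : p.2 ≤ (1 / 2) ^ (2 * k))
    (hqk : q.2 ≤ (1 / 2) ^ (2 * k)) :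
    dist (b^[k] p) (b^[k] q) ≤ max β₁ (1 / 2) ^ k := by
  have hfst : ∀ x ∈ Icc (0 : ℝ) 1, β₁ ^ k * x ∈ Icc (0 : ℝ) (max β₁ (1 / 2) ^ k) := fun x hx =>
    ⟨mul_nonneg (by positivity) hx.1, (mul_le_of_le_one_right (by positivity) hx.2).trans
      (pow_le_pow_left₀ hβ₁.le (le_max_left _ _) k)⟩
  have hhalf : ∀ y : ℝ, y ≤ (1 / 2) ^ (2 * k) → 2 ^ k * y ≤ (1 / 2) ^ k := fun y hy => by
    calc 2 ^ k * y ≤ 2 ^ k * (1 / 2) ^ (2 * k) := by gcongr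
      _ = (1 / 2) ^ k := by rw [pow_mul, ← mul_pow]; norm_num
  have hone : ((1 : ℝ) / 2) ^ k ≤ 1 := pow_le_one₀ (by norm_num) (by norm_num)
  have hsnd : ∀ y ∈ Ioc (0 : ℝ) 1, y ≤ (1 / 2) ^ (2 * k) →
      2 ^ k * y ∈ Icc (0 : ℝ) (max β₁ (1 / 2) ^ k) := fun y hy hyk =>
    ⟨mul_nonneg (by positivity) hy.1.le, (hhalf y hyk).trans
      (pow_le_pow_left₀ (by norm_num) (le_max_right _ _) k)⟩
  have habs : ∀ {c x y : ℝ}, x ∈ Icc 0 c → y ∈ Icc 0 c → dist x y ≤ c := fun hx hy => by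
    rw [Real.dist_eq, abs_le]; constructor <;> linarith [hx.1, hx.2, hy.1, hy.2]
  rw [baker_iterate_of_le hb k ((hhalf _ hpk).trans hone),
    baker_iterate_of_le hb k ((hhalf _ hqk).trans hone)]
  exact max_le (habs (hfst _ hp.1) (hfst _ hq.1)) (habs (hsnd _ hp.2 hpk) (hsnd _ hq.2 hqk))

theorem ae_forall_mem_liYorkePairs
    (hb : ∀ p : ℝ × ℝ,
      b p = if p.2 ≤ 1 / 2 then (β₁ * p.1, 2 * p.2) else (1 - β₂ + β₂ * p.1, 2 * p.2 - 1))
    (hβ₁ : β₁ ∈ Ioo (0 : ℝ) 1) {Λ : Set ℝ} (hΛI : Λ ⊆ Icc 0 1)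
    (h₁ : ∀ x ∈ Λ, β₁ * x ∈ Λ) (h₂ : ∀ x ∈ Λ, 1 - β₂ + β₂ * x ∈ Λ) :
    ∀ᵐ z ∂unitMeasure.prod unitMeasure, ∀ x ∈ Λ, ∀ x' ∈ Λ,
      ((x, z.1), (x', z.2)) ∈ liYorkePairs b (Λ ×ˢ Icc (0 : ℝ) 1) := by
  have hmem : ∀ᵐ z ∂unitMeasure.prod unitMeasure, z ∈ Ioc (0 : ℝ) 1 ×ˢ Ioc (0 : ℝ) 1 := by
    rw [unitMeasure, MeasureTheory.Measure.prod_restrict]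
    exact MeasureTheory.ae_restrict_mem (measurableSet_Ioc.prod measurableSet_Ioc)
  filter_upwards [hmem, ae_frequently_doubling_far,
    MeasureTheory.ae_all_iff.2 ae_frequently_doubling_small] with z hz hfar hsmall x hx x' hx'
  have hp := baker_iterate_mem hb h₁ h₂ (p := (x, z.1)) ⟨hx, hz.1⟩
  have hq := baker_iterate_mem hb h₁ h₂ (p := (x', z.2)) ⟨hx', hz.2⟩
  simp only [Prod.map_iterate] at hfar hsmall
  refine mem_liYorkePairs_of_frequently (R := 1) (δ := 1 / 2)
    ⟨hx, Ioc_subset_Icc_self hz.1⟩ ⟨hx', Ioc_subset_Icc_self hz.2⟩ (by norm_num) ?_ ?_ ?_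
  · intro n
    have habs : ∀ {x y : ℝ}, x ∈ Icc (0 : ℝ) 1 → y ∈ Icc (0 : ℝ) 1 → dist x y ≤ 1 :=
      fun hx hy => by
        rw [Real.dist_eq, abs_le]; constructor <;> linarith [hx.1, hx.2, hy.1, hy.2]
    exact max_le (habs (hΛI (hp n).1.1) (hΛI (hq n).1.1))
      (habs (Ioc_subset_Icc_self (hp n).1.2) (Ioc_subset_Icc_self (hq n).1.2))
  · intro ε hε
    obtain ⟨k, hk⟩ := exists_pow_lt_of_lt_one hε (max_lt hβ₁.2 (by norm_num : (1 / 2 : ℝ) < 1))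
    refine frequently_atTop.2 fun N => ?_
    obtain ⟨n, hn, hn1, hn2⟩ := frequently_atTop.1 (hsmall (2 * k)) N
    refine ⟨k + n, hn.trans (Nat.le_add_left _ _), le_trans ?_ hk.le⟩
    rw [Function.iterate_add_apply, Function.iterate_add_apply]
    exact dist_baker_iterate_le hb hβ₁.1 ⟨hΛI (hp n).1.1, (hp n).1.2⟩
      ⟨hΛI (hq n).1.1, (hq n).1.2⟩ k ((hp n).2.trans_le hn1) ((hq n).2.trans_le hn2)
  · refine hfar.mono fun n hn => le_trans ?_ (le_max_right _ _)
    have hn1 : (b^[n] (x, z.1)).2 ≤ 1 / 4 := (hp n).2.trans_le hn.1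
    have hn2 : 3 / 4 ≤ (b^[n] (x', z.2)).2 := hn.2.trans (hq n).2.ge
    rw [dist_comm, Real.dist_eq]
    exact le_trans (by linarith) (le_abs_self _)

end Baker

/-- Let `β₁, β₂ ∈ (0,1)` with `β₁ + β₂ < 1`, and let `b` be the skinny
baker's transformation `b(x,y) = (β₁ x, 2y)` if `y ≤ 1/2`, `b(x,y) = (1 − β₂ + β₂ x, 2y − 1)`
if `y > 1/2`. Let `Λ ⊆ ℝ` be the attractor of `T₁ x = β₁ x`, `T₂ x = 1 − β₂ + β₂ x` and
let `D` solve `β₁^D + β₂^D = 1`. Then the Li-Yorke pairs of `b` in `Λ × [0,1]` have full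
Hausdorff dimension: `dim_H LY_b(Λ × [0,1]) = dim_H ((Λ × [0,1])²) = 2(D + 1)`. -/
theorem dimH_liYorkePairs_skinny_baker (β₁ β₂ : ℝ)
    (hβ₁ : β₁ ∈ Set.Ioo (0 : ℝ) 1) (hβ₂ : β₂ ∈ Set.Ioo (0 : ℝ) 1) (hsum : β₁ + β₂ < 1)
    (b : ℝ × ℝ → ℝ × ℝ)
    (hb : ∀ p : ℝ × ℝ,
      b p = if p.2 ≤ 1 / 2 then (β₁ * p.1, 2 * p.2) else (1 - β₂ + β₂ * p.1, 2 * p.2 - 1))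
    (Λ : Set ℝ) (hΛc : IsCompact Λ) (hΛne : Λ.Nonempty)
    (hΛ : Λ = (fun x => β₁ * x) '' Λ ∪ (fun x => 1 - β₂ + β₂ * x) '' Λ)
    (D : ℝ) (hD : β₁ ^ D + β₂ ^ D = 1) :
    dimH (liYorkePairs b (Λ ×ˢ Set.Icc (0 : ℝ) 1)) =
      dimH ((Λ ×ˢ Set.Icc (0 : ℝ) 1) ×ˢ (Λ ×ˢ Set.Icc (0 : ℝ) 1)) ∧
    dimH ((Λ ×ˢ Set.Icc (0 : ℝ) 1) ×ˢ (Λ ×ˢ Set.Icc (0 : ℝ) 1)) =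
      ENNReal.ofReal (2 * (D + 1)) := by
  have hΛ' := hΛ.subset
  have hΛI := attractor_subset_Icc hβ₁ hβ₂ hΛc hΛne hΛ'
  have h₁ : ∀ x ∈ Λ, β₁ * x ∈ Λ := fun x hx => hΛ.superset (Or.inl (mem_image_of_mem _ hx))
  have h₂ : ∀ x ∈ Λ, 1 - β₂ + β₂ * x ∈ Λ :=
    fun x hx => hΛ.superset (Or.inr (mem_image_of_mem _ hx))
  have hD0 : 0 < D := by
    by_contra! h
    have := Real.one_le_rpow_of_pos_of_le_one_of_nonpos hβ₁.1 hβ₁.2.le h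
    have := Real.one_le_rpow_of_pos_of_le_one_of_nonpos hβ₂.1 hβ₂.2.le h
    linarith
  have hupper : dimH ((Λ ×ˢ Set.Icc (0 : ℝ) 1) ×ˢ (Λ ×ˢ Set.Icc (0 : ℝ) 1)) ≤
      ENNReal.ofReal (2 * (D + 1)) := by
    obtain ⟨K, hK⟩ := hasCoverBound_of_subset_union hβ₁ hβ₂ hD0.le hD hΛI hΛ'
    obtain ⟨K', hK'⟩ := hasCoverBound_Icc
    have hcover := (hK.prod hK').prod (hK.prod hK')
    rw [← two_mul] at hcover
    exact hcover.dimH_le (by positivity)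
  have hlower : ENNReal.ofReal (2 * (D + 1)) ≤
      dimH (liYorkePairs b (Λ ×ˢ Set.Icc (0 : ℝ) 1)) := by
    obtain ⟨φ, hφΛ, C, hC, hφ⟩ :=
      exists_coding_antiholder hβ₁ hβ₂ hsum hD0 hD hΛc.isClosed hΛne hΛI h₁ h₂
    refine ofReal_le_dimH_of_forall_measure_preimage_le
      ((unitMeasure.prod unitMeasure).prod (unitMeasure.prod unitMeasure)) (pairCoding φ)
      (by positivity) (ENNReal.pow_ne_top ENNReal.ofReal_ne_top)
      (measure_preimage_pairCoding_le hC.le hD0.le hφ) ?_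
    have hproj : MeasureTheory.MeasurePreserving
        (Prod.map Prod.snd Prod.snd : (ℝ × ℝ) × (ℝ × ℝ) → ℝ × ℝ)
        ((unitMeasure.prod unitMeasure).prod (unitMeasure.prod unitMeasure))
        (unitMeasure.prod unitMeasure) :=
      MeasureTheory.measurePreserving_snd.prod MeasureTheory.measurePreserving_snd
    have hfull : ∀ᵐ v ∂(unitMeasure.prod unitMeasure).prod (unitMeasure.prod unitMeasure),
        v ∈ pairCoding φ ⁻¹' liYorkePairs b (Λ ×ˢ Set.Icc (0 : ℝ) 1) := by
      filter_upwards [hproj.quasiMeasurePreserving.ae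
        (ae_forall_mem_liYorkePairs hb hβ₁ hΛI h₁ h₂)] with v hv
      exact hv _ (hφΛ _) _ (hφΛ _)
    rw [MeasureTheory.measure_eq_measure_of_null_sdiff (subset_univ _)
      (by rwa [← compl_eq_univ_sdiff])]
    simp
  have hsub : liYorkePairs b (Λ ×ˢ Set.Icc (0 : ℝ) 1) ⊆
      (Λ ×ˢ Set.Icc (0 : ℝ) 1) ×ˢ (Λ ×ˢ Set.Icc (0 : ℝ) 1) := fun _ hp => ⟨hp.1, hp.2.1⟩
  have hmono := dimH_mono hsub
  exact ⟨le_antisymm hmono (hupper.trans hlower), le_antisymm hupper (hlower.trans hmono)⟩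

end
end

section
/- Let β ∈ (0,1/2) and τ > 2, and let h : ℝ² → ℝ² be a map (Smale's horseshoe) satisfying h(x,y) = (βx, τy) for (x,y) ∈ [0,1] × [0, 1/τ] and h(x,y) = (−βx + 1, −τy + τ) for (x,y) ∈ [0,1] × [1 − 1/τ, 1]. Let Λ₁ ⊆ ℝ be the attractor of T₁x = βx, T₂x = −βx + 1, let Λ₂ ⊆ ℝ be the attractor of G₁y = y/τ, G₂y = −y/τ + 1, and set Λ = Λ₁ × Λ₂. Then Λ is invariant under h and the Li-Yorke pairs of h in Λ have full Hausdorff dimension: dim_H LY_h(Λ) = dim_H(Λ × Λ) = 2·log 2/log(1/β) + 2·log 2/log τ. -/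
open Filter Set

noncomputable section

open MeasureTheory ProbabilityTheory
open scoped ENNReal NNReal Topology

/-! ### Lower bounds: mass distribution -/

/-- The push-forward of `P` under `f` (as an outer measure) is `s`-Frostman. -/
def IsFrostman {Ω X : Type*} [MeasurableSpace Ω] [EMetricSpace X] (P : Measure Ω) (f : Ω → X)
    (s : ℝ) : Prop :=
  ∃ C : ℝ≥0∞, C ≠ ∞ ∧ ∀ S : Set X, P (f ⁻¹' S) ≤ C * Metric.ediam S ^ s

theorem IsFrostman.prodMap {Ω Ω' X Y : Type*} [MeasurableSpace Ω] [MeasurableSpace Ω']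
    [EMetricSpace X] [EMetricSpace Y] {P : Measure Ω} {Q : Measure Ω'} [SFinite Q]
    {f : Ω → X} {g : Ω' → Y} {s t : ℝ} (hs : 0 ≤ s) (ht : 0 ≤ t)
    (hf : IsFrostman P f s) (hg : IsFrostman Q g t) :
    IsFrostman (P.prod Q) (Prod.map f g) (s + t) := by
  obtain ⟨C, hC, hf⟩ := hf
  obtain ⟨D, hD, hg⟩ := hg
  refine ⟨C * D, ENNReal.mul_ne_top hC hD, fun S => ?_⟩
  have h1 : Metric.ediam (Prod.fst '' S) ≤ Metric.ediam S := by
    simpa using LipschitzWith.prod_fst.ediam_image_le S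
  have h2 : Metric.ediam (Prod.snd '' S) ≤ Metric.ediam S := by
    simpa using LipschitzWith.prod_snd.ediam_image_le S
  calc P.prod Q (Prod.map f g ⁻¹' S)
      ≤ P.prod Q ((f ⁻¹' (Prod.fst '' S)) ×ˢ (g ⁻¹' (Prod.snd '' S))) :=
        measure_mono fun p hp => ⟨⟨_, hp, rfl⟩, ⟨_, hp, rfl⟩⟩
    _ ≤ P (f ⁻¹' (Prod.fst '' S)) * Q (g ⁻¹' (Prod.snd '' S)) := Measure.prod_prod_le _ _
    _ ≤ (C * Metric.ediam S ^ s) * (D * Metric.ediam S ^ t) := by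
        gcongr
        · exact (hf _).trans (by gcongr)
        · exact (hg _).trans (by gcongr)
    _ = C * D * Metric.ediam S ^ (s + t) := by
        rw [ENNReal.rpow_add_of_nonneg _ _ hs ht]; ring

theorem IsFrostman.le_dimH {Ω X : Type*} [MeasurableSpace Ω] [EMetricSpace X] {P : Measure Ω}
    {f : Ω → X} {d : ℝ≥0} (hf : IsFrostman P f d) {A : Set X} (hA : P (f ⁻¹' A) ≠ 0) :
    (d : ℝ≥0∞) ≤ dimH A := by
  borelize X
  obtain ⟨C, hC, hf⟩ := hf
  have hC1 : C + 1 ≠ ∞ := by finiteness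
  have key : (C + 1)⁻¹ • OuterMeasure.map f P.toOuterMeasure ≤
      OuterMeasure.mkMetric fun r => r ^ (d : ℝ) := by
    refine OuterMeasure.le_mkMetric _ _ 1 one_pos fun S _ => ?_
    change (C + 1)⁻¹ * P (f ⁻¹' S) ≤ _
    rw [mul_comm, ← div_eq_mul_inv]
    refine ENNReal.div_le_of_le_mul ((hf S).trans ?_)
    rw [mul_comm]
    gcongr
    exact le_self_add
  refine le_dimH_of_hausdorffMeasure_ne_zero fun h0 => hA ?_
  have h := key A
  rw [OuterMeasure.coe_mkMetric] at h
  change (C + 1)⁻¹ * P (f ⁻¹' A) ≤ μH[d] A at h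
  rw [h0, nonpos_iff_eq_zero, mul_eq_zero, ENNReal.inv_eq_zero] at h
  exact h.resolve_left hC1

/-! ### Upper bounds: coverings -/

/-- `K` can be covered by at most `C * ρ ^ (-s)` sets of diameter at most `ρ`. -/
def HasBoxCover {X : Type*} [EMetricSpace X] (K : Set X) (s : ℝ) : Prop :=
  ∃ C : ℝ≥0∞, C ≠ ∞ ∧ ∀ ρ : ℝ, 0 < ρ → ρ < 1 → ∃ (ι : Type) (_ : Fintype ι) (u : ι → Set X),
    K ⊆ ⋃ i, u i ∧ (∀ i, Metric.ediam (u i) ≤ ENNReal.ofReal ρ) ∧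
      (Fintype.card ι : ℝ≥0∞) * ENNReal.ofReal ρ ^ s ≤ C

theorem ediam_prod_le {X Y : Type*} [EMetricSpace X] [EMetricSpace Y] (u : Set X) (v : Set Y) :
    Metric.ediam (u ×ˢ v) ≤ max (Metric.ediam u) (Metric.ediam v) :=
  Metric.ediam_le fun _ hp _ hq =>
    max_le_max (Metric.edist_le_ediam_of_mem hp.1 hq.1) (Metric.edist_le_ediam_of_mem hp.2 hq.2)

theorem HasBoxCover.prod {X Y : Type*} [EMetricSpace X] [EMetricSpace Y] {K : Set X} {L : Set Y}
    {s t : ℝ} (hs : 0 ≤ s) (ht : 0 ≤ t) (hK : HasBoxCover K s) (hL : HasBoxCover L t) :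
    HasBoxCover (K ×ˢ L) (s + t) := by
  obtain ⟨C, hC, hK⟩ := hK
  obtain ⟨D, hD, hL⟩ := hL
  refine ⟨C * D, ENNReal.mul_ne_top hC hD, fun ρ h0 h1 => ?_⟩
  obtain ⟨ι, _, u, hu, hud, hc⟩ := hK ρ h0 h1
  obtain ⟨κ, _, v, hv, hvd, hd⟩ := hL ρ h0 h1
  refine ⟨ι × κ, inferInstance, fun i => u i.1 ×ˢ v i.2, ?_, fun i => ?_, ?_⟩
  · rintro ⟨x, y⟩ ⟨hx, hy⟩
    obtain ⟨i, hi⟩ := mem_iUnion.1 (hu hx)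
    obtain ⟨j, hj⟩ := mem_iUnion.1 (hv hy)
    exact mem_iUnion.2 ⟨(i, j), hi, hj⟩
  · exact (ediam_prod_le _ _).trans (max_le (hud _) (hvd _))
  · rw [ENNReal.rpow_add_of_nonneg _ _ hs ht, Fintype.card_prod, Nat.cast_mul, mul_mul_mul_comm]
    exact mul_le_mul' hc hd

theorem HasBoxCover.dimH_le {X : Type*} [EMetricSpace X] {K : Set X} {s : ℝ≥0}
    (hK : HasBoxCover K s) : dimH K ≤ s := by
  borelize X
  obtain ⟨C, hC, hK⟩ := hK
  have hρ0 : ∀ n : ℕ, (0 : ℝ) < (1 / 2) ^ (n + 1) := fun n => by positivity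
  have hρ1 : ∀ n : ℕ, ((1 : ℝ) / 2) ^ (n + 1) < 1 := fun n =>
    pow_lt_one₀ (by norm_num) (by norm_num) (by simp)
  choose ι hι u hu hud hc using fun n : ℕ => hK _ (hρ0 n) (hρ1 n)
  refine dimH_le_of_hausdorffMeasure_ne_top (ne_top_of_le_ne_top hC ?_)
  have hlim : Tendsto (fun n : ℕ => ENNReal.ofReal ((1 / 2 : ℝ) ^ (n + 1))) atTop (𝓝 0) := by
    rw [← ENNReal.ofReal_zero]
    exact ENNReal.tendsto_ofReal ((tendsto_add_atTop_iff_nat 1).2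
      (tendsto_pow_atTop_nhds_zero_of_lt_one (by norm_num) (by norm_num)))
  refine (Measure.hausdorffMeasure_le_liminf_sum (s : ℝ) K _ hlim u
    (Eventually.of_forall hud) (Eventually.of_forall hu)).trans ?_
  refine liminf_le_of_frequently_le' (Frequently.of_forall fun n => le_trans ?_ (hc n))
  calc ∑ i, Metric.ediam (u n i) ^ (s : ℝ)
      ≤ ∑ _i : ι n, ENNReal.ofReal ((1 / 2 : ℝ) ^ (n + 1)) ^ (s : ℝ) := by
        gcongr with i
        exact hud n i
    _ = _ := by simp

/-! ### The coin-tossing measure -/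

/-- The uniform product measure on binary sequences. -/
def coin : Measure (ℕ → Bool) :=
  Measure.infinitePi fun _ => (PMF.uniformOfFintype Bool).toMeasure

instance : IsProbabilityMeasure coin := by unfold coin; infer_instance

theorem coin_cylinder (s : Finset ℕ) (u : ℕ → Bool) :
    coin {t | ∀ i ∈ s, t i = u i} = 2⁻¹ ^ s.card := by
  have h : {t : ℕ → Bool | ∀ i ∈ s, t i = u i} = Set.pi s fun i => {u i} := by
    ext t; simp [Set.mem_pi]
  rw [h, coin, Measure.infinitePi_pi _ fun i _ => measurableSet_singleton _]
  simp

theorem measurableSet_cylinder (s : Finset ℕ) (u : ℕ → Bool) :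
    MeasurableSet {t : ℕ → Bool | ∀ i ∈ s, t i = u i} := by
  simp only [ofPred_forall]
  exact Finset.measurableSet_biInter s fun i _ =>
    measurable_pi_apply i (measurableSet_singleton _)

/-- Almost every binary sequence agrees with `u` on infinitely many blocks of length `k`. -/
theorem ae_frequently_agree (u : ℕ → Bool) (k : ℕ) :
    ∀ᵐ t ∂coin, ∃ᶠ j in atTop, ∀ i < k, t (j * k + i) = u (j * k + i) := by
  set B : ℕ → Finset ℕ := fun j => (Finset.range k).image (j * k + ·) with hB
  have hBc : ∀ j, (B j).card = k := fun j => by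
    rw [hB, Finset.card_image_of_injective _ (add_right_injective _), Finset.card_range]
  have hdisj : ∀ i j, i ≠ j → Disjoint (B i) (B j) := by
    intro i j hij
    rw [Finset.disjoint_left]
    intro a ha hb
    simp only [hB, Finset.mem_image, Finset.mem_range] at ha hb
    obtain ⟨x, hx, rfl⟩ := ha
    obtain ⟨y, hy, hxy⟩ := hb
    apply hij
    have hk : 0 < k := by omega
    have h1 : (i * k + x) / k = i := by
      rw [add_comm, Nat.add_mul_div_right _ _ hk, Nat.div_eq_of_lt hx, zero_add]
    have h2 : (j * k + y) / k = j := by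
      rw [add_comm, Nat.add_mul_div_right _ _ hk, Nat.div_eq_of_lt hy, zero_add]
    rw [← h1, ← h2, hxy]
  set E : ℕ → Set (ℕ → Bool) := fun j => {t | ∀ i ∈ B j, t i = u i} with hE
  have hEm : ∀ j, MeasurableSet (E j) := fun j => measurableSet_cylinder _ _
  have hEc : ∀ j, coin (E j) = 2⁻¹ ^ k := fun j => by rw [hE, coin_cylinder, hBc]
  have hind : iIndepSet E coin := by
    rw [iIndepSet_iff_meas_biInter hEm]
    intro s
    have : (⋂ i ∈ s, E i) = {t | ∀ i ∈ s.biUnion B, t i = u i} := by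
      ext t
      simp only [hE, mem_iInter, mem_ofPred_eq, Finset.mem_biUnion]
      grind
    rw [this, coin_cylinder, Finset.card_biUnion fun i _ j _ => hdisj i j]
    simp [hBc, hEc, pow_mul, mul_comm]
  have hlim := measure_limsup_eq_one hEm hind (by
    simp only [hEc]
    exact ENNReal.tsum_const_eq_top_of_ne_zero (by simp))
  have hae : ∀ᵐ t ∂coin, t ∈ limsup E atTop :=
    (prob_compl_eq_zero_iff (MeasurableSet.measurableSet_limsup hEm)).2 hlim
  filter_upwards [hae] with t ht
  rw [mem_limsup_iff_frequently_mem] at ht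
  exact ht.mono fun j hj i hi => hj _ (Finset.mem_image.2 ⟨i, Finset.mem_range.2 hi, rfl⟩)

theorem ae_prod_frequently_agree (φ : Bool → Bool) (k : ℕ) :
    ∀ᵐ p ∂coin.prod coin, ∃ᶠ j in atTop, ∀ i < k, p.2 (j * k + i) = φ (p.1 (j * k + i)) := by
  refine (Measure.ae_prod_mem_iff_ae_ae_mem (s := {p : (ℕ → Bool) × (ℕ → Bool) |
    ∃ᶠ j in atTop, ∀ i < k, p.2 (j * k + i) = φ (p.1 (j * k + i))}) ?_).2
    (Eventually.of_forall fun t => ae_frequently_agree (fun n => φ (t n)) k)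
  simp only [frequently_atTop, ofPred_forall, ofPred_exists, ofPred_and]
  refine .iInter fun N => .iUnion fun j => .inter (.const _) (.iInter fun i => .iInter fun _ => ?_)
  exact measurableSet_eq_fun ((measurable_pi_apply _).comp measurable_snd)
    ((Measurable.of_discrete (f := φ)).comp ((measurable_pi_apply _).comp measurable_fst))

/-! ### The Cantor sets generated by `x ↦ r x` and `x ↦ 1 - r x` -/

/-- The two contractions of ratio `r`: `x ↦ 1 - r x` for `true` and `x ↦ r x` for `false`. -/
def branch (r : ℝ) (b : Bool) (x : ℝ) : ℝ := cond b (1 - r * x) (r * x)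

theorem dist_branch {r : ℝ} (hr : 0 ≤ r) (b : Bool) (x y : ℝ) :
    dist (branch r b x) (branch r b y) = r * dist x y := by
  cases b
  · simp only [branch, cond_false, Real.dist_eq, ← mul_sub, abs_mul, abs_of_nonneg hr]
  · simp only [branch, cond_true, Real.dist_eq, sub_sub_sub_cancel_left, ← mul_sub, abs_mul,
      abs_of_nonneg hr, abs_sub_comm]

theorem continuous_branch (r : ℝ) (b : Bool) : Continuous (branch r b) := by
  unfold branch; cases b <;> simp only [cond_true, cond_false] <;> fun_prop

theorem branch_mem_Icc {r x : ℝ} (h0 : 0 ≤ r) (h1 : r ≤ 1) (b : Bool) (hx : x ∈ Icc (0 : ℝ) 1) :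
    branch r b x ∈ Icc (0 : ℝ) 1 := by
  have := mul_le_one₀ h1 hx.1 hx.2
  have := mul_nonneg h0 hx.1
  cases b <;> constructor <;> simp only [branch, cond_true, cond_false] <;> linarith

/-- `K` is the attractor of the two branches of ratio `r < 1 / 2`. -/
structure IsBranchAttractor (r : ℝ) (K : Set ℝ) : Prop where
  pos : 0 < r
  lt_half : r < 1 / 2
  isCompact : IsCompact K
  nonempty : K.Nonempty
  mem_iff : ∀ x, x ∈ K ↔ ∃ b, ∃ y ∈ K, branch r b y = x

namespace IsBranchAttractor

variable {r : ℝ} {K : Set ℝ}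

theorem branch_mem (hK : IsBranchAttractor r K) (b : Bool) {x : ℝ} (hx : x ∈ K) :
    branch r b x ∈ K := (hK.mem_iff _).2 ⟨b, x, hx, rfl⟩

theorem subset_Icc (hK : IsBranchAttractor r K) : K ⊆ Icc 0 1 := by
  obtain ⟨M, hM⟩ := hK.isCompact.exists_isGreatest hK.nonempty
  obtain ⟨m, hm⟩ := hK.isCompact.exists_isLeast hK.nonempty
  have h0 := hK.pos
  have h1 := hK.lt_half
  have hmM : m ≤ M := hM.2 hm.1
  suffices 0 ≤ m ∧ M ≤ 1 from fun x hx => ⟨this.1.trans (hm.2 hx), (hM.2 hx).trans this.2⟩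
  obtain ⟨b, y, hy, hyM⟩ := (hK.mem_iff M).1 hM.1
  obtain ⟨c, z, hz, hzm⟩ := (hK.mem_iff m).1 hm.1
  have y1 := mul_le_mul_of_nonneg_left (hM.2 hy) h0.le
  have y2 := mul_le_mul_of_nonneg_left (hm.2 hy) h0.le
  have z1 := mul_le_mul_of_nonneg_left (hM.2 hz) h0.le
  have z2 := mul_le_mul_of_nonneg_left (hm.2 hz) h0.le
  cases b <;> cases c <;> simp only [branch, cond_true, cond_false] at hyM hzm <;>
    constructor <;> nlinarith

/-- Every point of the code space has a corresponding point in the attractor. -/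
theorem exists_coding (hK : IsBranchAttractor r K) :
    ∃ π : (ℕ → Bool) → ℝ, ∀ t, π t ∈ K ∧ π t = branch r (t 0) (π fun n => t (n + 1)) := by
  have hr1 : r < 1 := hK.lt_half.trans (by norm_num)
  obtain ⟨y₀, hy₀⟩ := hK.nonempty
  let a : ℕ → (ℕ → Bool) → ℝ :=
    fun n => Nat.rec (fun _ => y₀) (fun _ f t => branch r (t 0) (f fun n => t (n + 1))) n
  have ha : ∀ n t, a (n + 1) t = branch r (t 0) (a n fun n => t (n + 1)) := fun _ _ => rfl
  have hmem : ∀ n t, a n t ∈ K := by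
    intro n
    induction n with
    | zero => exact fun _ => hy₀
    | succ n ih => exact fun t => hK.branch_mem _ (ih _)
  have hdist : ∀ n t, dist (a n t) (a (n + 1) t) ≤ 1 * r ^ n := by
    intro n
    induction n with
    | zero =>
      intro t
      simpa using Real.dist_le_of_mem_Icc_01 (hK.subset_Icc (hmem 0 t)) (hK.subset_Icc (hmem 1 t))
    | succ n ih =>
      intro t
      rw [ha (n + 1), ha n, dist_branch hK.pos.le, pow_succ']
      have := mul_le_mul_of_nonneg_left (ih fun n => t (n + 1)) hK.pos.le
      linarith
  choose π hπ using fun t => cauchySeq_tendsto_of_complete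
    (cauchySeq_of_le_geometric r 1 hr1 fun n => hdist n t)
  refine ⟨π, fun t => ⟨hK.isCompact.isClosed.mem_of_tendsto (hπ t)
    (Eventually.of_forall fun n => hmem n t), ?_⟩⟩
  exact tendsto_nhds_unique ((tendsto_add_atTop_iff_nat 1).2 (hπ t))
    (((continuous_branch r (t 0)).tendsto _).comp (hπ _))

end IsBranchAttractor

/-- `π` is a coding map of the attractor of the two branches of ratio `r < 1 / 2`. -/
structure IsBranchCoding (r : ℝ) (π : (ℕ → Bool) → ℝ) : Prop where
  pos : 0 < r
  lt_half : r < 1 / 2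
  mem_Icc : ∀ t, π t ∈ Icc (0 : ℝ) 1
  eq_branch : ∀ t, π t = branch r (t 0) (π fun n => t (n + 1))

namespace IsBranchCoding

variable {r : ℝ} {π : (ℕ → Bool) → ℝ}

theorem dist_le_pow (hπ : IsBranchCoding r π) (n : ℕ) :
    ∀ t t' : ℕ → Bool, (∀ i < n, t i = t' i) → dist (π t) (π t') ≤ r ^ n := by
  induction n with
  | zero =>
    intro t t' _
    simpa using Real.dist_le_of_mem_Icc_01 (hπ.mem_Icc t) (hπ.mem_Icc t')
  | succ n ih =>
    intro t t' h
    rw [hπ.eq_branch t, hπ.eq_branch t', h 0 n.succ_pos, dist_branch hπ.pos.le, pow_succ']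
    exact mul_le_mul_of_nonneg_left (ih _ _ fun i hi => h _ (by omega)) hπ.pos.le

theorem le_dist_of_ne (hπ : IsBranchCoding r π) {t t' : ℕ → Bool} (h : t 0 ≠ t' 0) :
    1 - 2 * r ≤ dist (π t) (π t') := by
  wlog h' : t 0 = true generalizing t t'
  · rw [dist_comm]
    exact this h.symm (by grind)
  have h'' : t' 0 = false := by grind
  obtain ⟨-, hx⟩ := hπ.mem_Icc fun n => t (n + 1)
  obtain ⟨-, hy⟩ := hπ.mem_Icc fun n => t' (n + 1)
  have h1 := mul_le_mul_of_nonneg_left hx hπ.pos.le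
  have h2 := mul_le_mul_of_nonneg_left hy hπ.pos.le
  rw [hπ.eq_branch t, hπ.eq_branch t', h', h'']
  refine le_trans ?_ (le_abs_self _)
  simp only [branch, cond_true, cond_false]
  linarith

theorem agree_of_dist_lt (hπ : IsBranchCoding r π) (n : ℕ) :
    ∀ t t' : ℕ → Bool, dist (π t) (π t') < r ^ n * (1 - 2 * r) → ∀ i < n, t i = t' i := by
  induction n with
  | zero => intro t t' _ i hi; omega
  | succ n ih =>
    intro t t' h
    have h0 : t 0 = t' 0 := by
      by_contra hne
      have h1 := hπ.le_dist_of_ne hne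
      have h2 : r ^ (n + 1) ≤ 1 := pow_le_one₀ hπ.pos.le (by linarith [hπ.lt_half])
      nlinarith [hπ.lt_half]
    rw [hπ.eq_branch t, hπ.eq_branch t', h0, dist_branch hπ.pos.le, pow_succ', mul_assoc] at h
    have h3 := ih _ _ (lt_of_mul_lt_mul_left h hπ.pos.le)
    intro i hi
    cases i with
    | zero => exact h0
    | succ i => exact h3 i (by omega)

end IsBranchCoding

/-- The similarity dimension of two contractions of ratio `r`. -/
def simDim (r : ℝ) : ℝ := Real.log 2 / Real.log (1 / r)

theorem simDim_nonneg {r : ℝ} (h0 : 0 < r) (h1 : r < 1) : 0 ≤ simDim r :=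
  div_nonneg (Real.log_nonneg (by norm_num)) (Real.log_nonneg (by rw [le_div_iff₀ h0]; linarith))

theorem rpow_simDim {r : ℝ} (h0 : 0 < r) (h1 : r < 1) :
    ENNReal.ofReal r ^ simDim r = 2⁻¹ := by
  have hl : Real.log r ≠ 0 := (Real.log_neg h0 h1).ne
  rw [ENNReal.ofReal_rpow_of_pos h0, Real.rpow_def_of_pos h0, simDim, one_div, Real.log_inv,
    div_neg, mul_neg, mul_div_cancel₀ _ hl, Real.exp_neg, Real.exp_log (by norm_num),
    ENNReal.ofReal_inv_of_pos (by norm_num)]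
  simp

theorem ofReal_pow_rpow_simDim {r : ℝ} (h0 : 0 < r) (h1 : r < 1) (n : ℕ) :
    ENNReal.ofReal (r ^ n) ^ simDim r = 2⁻¹ ^ n := by
  rw [ENNReal.ofReal_pow h0.le, ← rpow_simDim h0 h1, ← ENNReal.rpow_natCast,
    ← ENNReal.rpow_natCast, ← ENNReal.rpow_mul, ← ENNReal.rpow_mul, mul_comm]

theorem IsBranchCoding.isFrostman {r : ℝ} {π : (ℕ → Bool) → ℝ} (hπ : IsBranchCoding r π) :
    IsFrostman coin π (simDim r) := by
  have h0 := hπ.pos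
  have hr1 : r < 1 := hπ.lt_half.trans (by norm_num)
  have hc : 0 < 1 - 2 * r := by linarith [hπ.lt_half]
  have hs := simDim_nonneg h0 hr1
  set c := ENNReal.ofReal (1 - 2 * r) with hcdef
  have hc0 : c ≠ 0 := by simpa [hcdef] using hc
  have hct : c ≠ ∞ := ENNReal.ofReal_ne_top
  have hcyl : ∀ (S : Set ℝ) (n : ℕ), Metric.ediam S < ENNReal.ofReal (r ^ n) * c →
      coin (π ⁻¹' S) ≤ 2⁻¹ ^ n := by
    intro S n hS
    rcases (π ⁻¹' S).eq_empty_or_nonempty with h | ⟨u, hu⟩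
    · simp [h]
    rw [← Finset.card_range n, ← coin_cylinder (Finset.range n) u]
    refine measure_mono fun t ht i hi => hπ.agree_of_dist_lt n t u ?_ i (Finset.mem_range.1 hi)
    have h := (Metric.edist_le_ediam_of_mem (mem_preimage.1 ht) (mem_preimage.1 hu)).trans_lt hS
    rw [edist_dist, hcdef, ← ENNReal.ofReal_mul (by positivity)] at h
    exact (ENNReal.ofReal_lt_ofReal_iff (by positivity)).1 h
  refine ⟨2 * (c⁻¹) ^ simDim r, ENNReal.mul_ne_top (by simp)
    (ENNReal.rpow_ne_top_of_nonneg hs (by simpa using hc0)), fun S => ?_⟩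
  rw [mul_assoc, ← ENNReal.mul_rpow_of_nonneg _ _ hs, mul_comm c⁻¹, ← div_eq_mul_inv]
  have hdiv : ∀ x, Metric.ediam S / c < x → Metric.ediam S < x * c := fun x hx =>
    (ENNReal.div_lt_iff (.inl hc0) (.inl hct)).1 hx
  by_cases hbig : 1 ≤ Metric.ediam S / c
  · calc coin (π ⁻¹' S) ≤ 1 := prob_le_one
      _ ≤ 2 * 1 := by norm_num
      _ ≤ _ := by gcongr; simpa using ENNReal.rpow_le_rpow hbig hs
  push Not at hbig
  by_cases hz : Metric.ediam S / c = 0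
  · have hlim : Tendsto (fun n : ℕ => (2⁻¹ : ℝ≥0∞) ^ n) atTop (𝓝 0) :=
      ENNReal.tendsto_pow_atTop_nhds_zero_of_lt_one (by simp)
    refine (ge_of_tendsto' hlim fun n => hcyl S n (hdiv _ ?_)).trans zero_le
    rw [hz]
    exact ENNReal.ofReal_pos.2 (by positivity)
  have hzt : Metric.ediam S / c ≠ ∞ := (hbig.trans ENNReal.one_lt_top).ne
  obtain ⟨δ, hδ0, hδ⟩ : ∃ δ : ℝ, 0 < δ ∧ Metric.ediam S / c = ENNReal.ofReal δ :=
    ⟨_, ENNReal.toReal_pos hz hzt, (ENNReal.ofReal_toReal hzt).symm⟩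
  rw [hδ] at hbig hdiv ⊢
  have hδ1 : δ < 1 := by simpa using hbig
  obtain ⟨n, hn, hn'⟩ := exists_nat_pow_near_of_lt_one hδ0 hδ1.le h0 hr1
  obtain ⟨m, hm, hm'⟩ : ∃ n : ℕ, r ^ (n + 1) ≤ δ ∧ δ < r ^ n := by
    rcases hn'.lt_or_eq with h | h
    · exact ⟨n, hn.le, h⟩
    · cases n with
      | zero => simp at h; linarith
      | succ n => exact ⟨n, h.ge, h ▸ pow_lt_pow_right_of_lt_one₀ h0 hr1 (Nat.lt_succ_self n)⟩
  calc coin (π ⁻¹' S) ≤ 2⁻¹ ^ m := hcyl S m (hdiv _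
        ((ENNReal.ofReal_lt_ofReal_iff (by positivity)).2 hm'))
    _ = 2 * 2⁻¹ ^ (m + 1) := by
        rw [pow_succ', ← mul_assoc, ENNReal.mul_inv_cancel (by simp) (by simp), one_mul]
    _ = 2 * ENNReal.ofReal (r ^ (m + 1)) ^ simDim r := by rw [ofReal_pow_rpow_simDim h0 hr1]
    _ ≤ _ := by gcongr

theorem IsBranchAttractor.exists_cover {r : ℝ} {K : Set ℝ} (hK : IsBranchAttractor r K) (n : ℕ) :
    ∃ (ι : Type) (_ : Fintype ι) (u : ι → Set ℝ), K ⊆ ⋃ i, u i ∧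
      (∀ i, Metric.ediam (u i) ≤ ENNReal.ofReal (r ^ n)) ∧ Fintype.card ι = 2 ^ n := by
  induction n with
  | zero =>
    refine ⟨Unit, inferInstance, fun _ => Icc 0 1, ?_, fun _ => ?_, by simp⟩
    · exact hK.subset_Icc.trans (subset_iUnion_of_subset () subset_rfl)
    · simp [Real.ediam_Icc]
  | succ n ih =>
    obtain ⟨ι, _, u, hu, hud, hc⟩ := ih
    refine ⟨Bool × ι, inferInstance, fun i => branch r i.1 '' u i.2, fun x hx => ?_, fun i => ?_,
      by rw [Fintype.card_prod, hc, Fintype.card_bool, pow_succ']⟩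
    · obtain ⟨b, y, hy, rfl⟩ := (hK.mem_iff x).1 hx
      obtain ⟨i, hi⟩ := mem_iUnion.1 (hu hy)
      exact mem_iUnion.2 ⟨(b, i), y, hi, rfl⟩
    · rw [pow_succ', ENNReal.ofReal_mul hK.pos.le]
      refine Metric.ediam_le ?_
      rintro _ ⟨x, hx, rfl⟩ _ ⟨y, hy, rfl⟩
      rw [edist_dist, dist_branch hK.pos.le, ENNReal.ofReal_mul hK.pos.le, ← edist_dist]
      gcongr
      exact (Metric.edist_le_ediam_of_mem hx hy).trans (hud _)

theorem IsBranchAttractor.hasBoxCover {r : ℝ} {K : Set ℝ} (hK : IsBranchAttractor r K) :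
    HasBoxCover K (simDim r) := by
  have hr1 : r < 1 := hK.lt_half.trans (by norm_num)
  refine ⟨2, by simp, fun ρ h0 h1 => ?_⟩
  obtain ⟨n, hn, hn'⟩ := exists_nat_pow_near_of_lt_one h0 h1.le hK.pos hr1
  obtain ⟨ι, _, u, hu, hud, hc⟩ := hK.exists_cover (n + 1)
  refine ⟨ι, inferInstance, u, hu, fun i => (hud i).trans (by gcongr), ?_⟩
  have hs := simDim_nonneg hK.pos hr1
  calc (Fintype.card ι : ℝ≥0∞) * ENNReal.ofReal ρ ^ simDim r
      ≤ (Fintype.card ι : ℝ≥0∞) * ENNReal.ofReal (r ^ n) ^ simDim r := by gcongr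
    _ = 2 * (2 ^ n * 2⁻¹ ^ n) := by
        rw [ofReal_pow_rpow_simDim hK.pos hr1, hc]; push_cast; ring
    _ = 2 := by
        rw [← mul_pow, ENNReal.mul_inv_cancel (by simp) (by simp), one_pow, mul_one]

/-! ### The horseshoe on its invariant set -/

/-- The first coordinate of the `n`-th iterate of a point with first coordinate `x` whose second
coordinate has code `ω`. -/
def stablePart (β : ℝ) (ω : ℕ → Bool) (x : ℝ) : ℕ → ℝ
  | 0 => x
  | n + 1 => branch β (ω n) (stablePart β ω x n)

theorem stablePart_mem_Icc {β x : ℝ} (h0 : 0 ≤ β) (h1 : β ≤ 1) (hx : x ∈ Icc (0 : ℝ) 1)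
    (ω : ℕ → Bool) (n : ℕ) : stablePart β ω x n ∈ Icc (0 : ℝ) 1 := by
  induction n with
  | zero => exact hx
  | succ n ih => exact branch_mem_Icc h0 h1 _ ih

theorem dist_stablePart_le {β x x' : ℝ} (h0 : 0 ≤ β) (h1 : β ≤ 1) (hx : x ∈ Icc (0 : ℝ) 1)
    (hx' : x' ∈ Icc (0 : ℝ) 1) {ω ω' : ℕ → Bool} {n k : ℕ}
    (h : ∀ i < k, ω (n + i) = ω' (n + i)) :
    dist (stablePart β ω x (n + k)) (stablePart β ω' x' (n + k)) ≤ β ^ k := by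
  induction k with
  | zero =>
    simpa using Real.dist_le_of_mem_Icc_01 (stablePart_mem_Icc h0 h1 hx ω n)
      (stablePart_mem_Icc h0 h1 hx' ω' n)
  | succ k ih =>
    rw [← add_assoc, stablePart, stablePart, h k (Nat.lt_succ_self k), dist_branch h0, pow_succ']
    exact mul_le_mul_of_nonneg_left (ih fun i hi => h i (by omega)) h0

/-- `h` acts on the unit square as the horseshoe with contraction `β` and expansion `1 / γ`. -/
def IsHorseshoe (β γ : ℝ) (h : ℝ × ℝ → ℝ × ℝ) : Prop :=
  ∀ b, ∀ x ∈ Icc (0 : ℝ) 1, ∀ y ∈ Icc (0 : ℝ) 1, h (x, branch γ b y) = (branch β b x, y)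

theorem IsHorseshoe.image_prod {β γ : ℝ} {h : ℝ × ℝ → ℝ × ℝ} (hh : IsHorseshoe β γ h)
    {K L : Set ℝ} (hK : IsBranchAttractor β K) (hL : IsBranchAttractor γ L) :
    h '' (K ×ˢ L) = K ×ˢ L := by
  ext ⟨x, y⟩
  constructor
  · rintro ⟨⟨x', y'⟩, ⟨hx, hy⟩, heq⟩
    obtain ⟨b, z, hz, rfl⟩ := (hL.mem_iff y').1 hy
    rw [hh b x' (hK.subset_Icc hx) z (hL.subset_Icc hz)] at heq
    rw [← heq]
    exact ⟨hK.branch_mem b hx, hz⟩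
  · rintro ⟨hx, hy⟩
    obtain ⟨b, z, hz, rfl⟩ := (hK.mem_iff x).1 hx
    exact ⟨(z, branch γ b y), ⟨hz, hL.branch_mem b hy⟩,
      hh b z (hK.subset_Icc hz) y (hL.subset_Icc hy)⟩

theorem IsHorseshoe.iterate {β γ : ℝ} {h : ℝ × ℝ → ℝ × ℝ} (hh : IsHorseshoe β γ h)
    (h0 : 0 ≤ β) (h1 : β ≤ 1) {π : (ℕ → Bool) → ℝ} (hπ : IsBranchCoding γ π) {x : ℝ}
    (hx : x ∈ Icc (0 : ℝ) 1) (ω : ℕ → Bool) (n : ℕ) :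
    h^[n] (x, π ω) = (stablePart β ω x n, π fun i => ω (n + i)) := by
  induction n with
  | zero => simp [stablePart]
  | succ n ih =>
    rw [Function.iterate_succ_apply', ih, hπ.eq_branch,
      hh _ _ (stablePart_mem_Icc h0 h1 hx ω n) _ (hπ.mem_Icc _)]
    simp only [stablePart, add_zero, add_assoc, add_comm 1]

theorem IsHorseshoe.mem_liYorkePairs {β γ : ℝ} {h : ℝ × ℝ → ℝ × ℝ} (hh : IsHorseshoe β γ h)
    {K L : Set ℝ} (hK : IsBranchAttractor β K) {π : (ℕ → Bool) → ℝ} (hπ : IsBranchCoding γ π)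
    (hπL : ∀ t, π t ∈ L) {x x' : ℝ} (hx : x ∈ K) (hx' : x' ∈ K) {ω ω' : ℕ → Bool}
    (hagree : ∀ k : ℕ, ∃ᶠ j in atTop, ∀ i < k, ω' (j * k + i) = ω (j * k + i))
    (hne : ∃ᶠ j in atTop, ω' j ≠ ω j) :
    ((x, π ω), (x', π ω')) ∈ liYorkePairs h (K ×ˢ L) := by
  have h0 := hK.pos.le
  have hβ1 : β < 1 := hK.lt_half.trans (by norm_num)
  have hγ1 : γ < 1 := hπ.lt_half.trans (by norm_num)
  have hxI := hK.subset_Icc hx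
  have hxI' := hK.subset_Icc hx'
  refine ⟨⟨hx, hπL _⟩, ⟨hx', hπL _⟩, ?_⟩
  simp only [hh.iterate h0 hβ1.le hπ hxI, hh.iterate h0 hβ1.le hπ hxI', Prod.dist_eq]
  set d : ℕ → ℝ := fun n => max (dist (stablePart β ω x n) (stablePart β ω' x' n))
    (dist (π fun i => ω (n + i)) (π fun i => ω' (n + i)))
  have hd0 : ∀ n, 0 ≤ d n := fun n => le_max_of_le_left dist_nonneg
  have hd1 : ∀ n, d n ≤ 1 := fun n => max_le
    (Real.dist_le_of_mem_Icc_01 (stablePart_mem_Icc h0 hβ1.le hxI ω n)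
      (stablePart_mem_Icc h0 hβ1.le hxI' ω' n))
    (Real.dist_le_of_mem_Icc_01 (hπ.mem_Icc _) (hπ.mem_Icc _))
  have hbdd : IsBoundedUnder (· ≤ ·) atTop d := isBoundedUnder_of ⟨1, hd1⟩
  have hbdd' : IsBoundedUnder (· ≥ ·) atTop d := isBoundedUnder_of ⟨0, hd0⟩
  constructor
  · refine le_antisymm (le_of_forall_pos_le_add fun ε hε => ?_)
      (le_liminf_of_le hbdd.isCoboundedUnder_ge (Eventually.of_forall hd0))
    rw [zero_add]
    refine liminf_le_of_frequently_le ?_ hbdd'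
    obtain ⟨k, hk1, hk2⟩ :=
      (((tendsto_pow_atTop_nhds_zero_of_lt_one h0 hβ1).eventually_le_const hε).and
        ((tendsto_pow_atTop_nhds_zero_of_lt_one hπ.pos.le hγ1).eventually_le_const hε)).exists
    rw [frequently_atTop]
    intro N
    obtain ⟨j, hj, hjk⟩ := frequently_atTop.1 (hagree (k + k + 1)) N
    refine ⟨j * (k + k + 1) + k, ?_, max_le ?_ ?_⟩
    · show N ≤ _
      nlinarith [Nat.zero_le (j * k)]
    · exact (dist_stablePart_le h0 hβ1.le hxI hxI'
        fun i hi => (hjk i (by omega)).symm).trans hk1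
    · exact (hπ.dist_le_pow k _ _ fun i hi => by
        simpa only [add_assoc] using (hjk (k + i) (by omega)).symm).trans hk2
  · have hpos : 0 < 1 - 2 * γ := by linarith [hπ.lt_half]
    refine hpos.trans_le (le_limsup_of_frequently_le (hne.mono fun j hj => ?_) hbdd)
    exact le_max_of_le_right (hπ.le_dist_of_ne fun heq => hj heq.symm)

theorem IsHorseshoe.le_dimH_liYorkePairs {β γ : ℝ} {h : ℝ × ℝ → ℝ × ℝ} (hh : IsHorseshoe β γ h)
    {K L : Set ℝ} (hK : IsBranchAttractor β K) (hL : IsBranchAttractor γ L) :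
    ENNReal.ofReal (simDim β + simDim γ + (simDim β + simDim γ)) ≤
      dimH (liYorkePairs h (K ×ˢ L)) := by
  obtain ⟨ξ, hξ⟩ := hK.exists_coding
  obtain ⟨π, hπ⟩ := hL.exists_coding
  have hξc : IsBranchCoding β ξ :=
    ⟨hK.pos, hK.lt_half, fun t => hK.subset_Icc (hξ t).1, fun t => (hξ t).2⟩
  have hπc : IsBranchCoding γ π :=
    ⟨hL.pos, hL.lt_half, fun t => hL.subset_Icc (hπ t).1, fun t => (hπ t).2⟩
  have hsβ := simDim_nonneg hK.pos (hK.lt_half.trans (by norm_num))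
  have hsγ := simDim_nonneg hL.pos (hL.lt_half.trans (by norm_num))
  have hF := hξc.isFrostman.prodMap hsβ hsγ hπc.isFrostman
  have hFF := hF.prodMap (add_nonneg hsβ hsγ) (add_nonneg hsβ hsγ) hF
  rw [← Real.coe_toNNReal _ (add_nonneg (add_nonneg hsβ hsγ) (add_nonneg hsβ hsγ))] at hFF
  refine hFF.le_dimH fun hzero => ?_
  have hq : Measure.QuasiMeasurePreserving
      (Prod.map Prod.snd Prod.snd : ((ℕ → Bool) × (ℕ → Bool)) × ((ℕ → Bool) × (ℕ → Bool)) → _)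
      ((coin.prod coin).prod (coin.prod coin)) (coin.prod coin) :=
    (measurePreserving_snd.prod measurePreserving_snd).quasiMeasurePreserving
  have hagree := hq.ae (ae_all_iff.2 fun k => ae_prod_frequently_agree id k)
  have hne := hq.ae (ae_prod_frequently_agree not 1)
  obtain ⟨⟨⟨a, ω⟩, ⟨a', ω'⟩⟩, ⟨hag, hn⟩, hnot⟩ :=
    ((hagree.and hne).and (measure_eq_zero_iff_ae_notMem.1 hzero)).exists
  exact hnot (hh.mem_liYorkePairs hK hπc (fun t => (hπ t).1) (hξ a).1 (hξ a').1 hag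
    (hn.mono fun j hj => by simpa [Bool.eq_not] using hj 0 one_pos))


/-- Let `β ∈ (0,1/2)`, `τ > 2`, and let `h` be Smale's horseshoe map,
with `h(x,y) = (βx, τy)` on `[0,1] × [0,1/τ]` and `h(x,y) = (−βx + 1, −τy + τ)` on
`[0,1] × [1 − 1/τ, 1]`. Let `Λ₁` be the attractor of `T₁ x = βx`, `T₂ x = −βx + 1`, let
`Λ₂` be the attractor of `G₁ y = y/τ`, `G₂ y = −y/τ + 1`, and `Λ = Λ₁ × Λ₂`. Then `Λ` is
invariant under `h` and `dim_H LY_h(Λ) = dim_H (Λ × Λ) = 2 log 2 / log (1/β) + 2 log 2 / log τ`. -/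
theorem dimH_liYorkePairs_horseshoe (β τ : ℝ)
    (hβ : β ∈ Set.Ioo (0 : ℝ) (1 / 2)) (hτ : 2 < τ)
    (h : ℝ × ℝ → ℝ × ℝ)
    (h1 : ∀ p : ℝ × ℝ, p.1 ∈ Set.Icc (0 : ℝ) 1 → p.2 ∈ Set.Icc (0 : ℝ) (1 / τ) →
      h p = (β * p.1, τ * p.2))
    (h2 : ∀ p : ℝ × ℝ, p.1 ∈ Set.Icc (0 : ℝ) 1 → p.2 ∈ Set.Icc (1 - 1 / τ) 1 →
      h p = (-β * p.1 + 1, -τ * p.2 + τ))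
    (Λ₁ : Set ℝ) (hΛ₁c : IsCompact Λ₁) (hΛ₁ne : Λ₁.Nonempty)
    (hΛ₁ : Λ₁ = (fun x => β * x) '' Λ₁ ∪ (fun x => -β * x + 1) '' Λ₁)
    (Λ₂ : Set ℝ) (hΛ₂c : IsCompact Λ₂) (hΛ₂ne : Λ₂.Nonempty)
    (hΛ₂ : Λ₂ = (fun y => y / τ) '' Λ₂ ∪ (fun y => -(y / τ) + 1) '' Λ₂) :
    h '' (Λ₁ ×ˢ Λ₂) = Λ₁ ×ˢ Λ₂ ∧
    dimH (liYorkePairs h (Λ₁ ×ˢ Λ₂)) = dimH ((Λ₁ ×ˢ Λ₂) ×ˢ (Λ₁ ×ˢ Λ₂)) ∧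
    dimH ((Λ₁ ×ˢ Λ₂) ×ˢ (Λ₁ ×ˢ Λ₂)) =
      ENNReal.ofReal (2 * Real.log 2 / Real.log (1 / β) + 2 * Real.log 2 / Real.log τ) := by
  have hτ0 : 0 < τ := by linarith
  have hK : IsBranchAttractor β Λ₁ := ⟨hβ.1, hβ.2, hΛ₁c, hΛ₁ne, fun x => by
    nth_rw 1 [hΛ₁]
    simp [branch, sub_eq_neg_add]⟩
  have hL : IsBranchAttractor (1 / τ) Λ₂ := ⟨by positivity,
    one_div_lt_one_div_of_lt (by norm_num) hτ, hΛ₂c, hΛ₂ne, fun x => by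
    nth_rw 1 [hΛ₂]
    simp [branch, sub_eq_neg_add, div_eq_inv_mul]⟩
  have hh : IsHorseshoe β (1 / τ) h := by
    intro b x hx y hy
    have hy0 := mul_nonneg hL.pos.le hy.1
    have hy1 := mul_le_mul_of_nonneg_left hy.2 hL.pos.le
    cases b
    · rw [h1 _ hx ⟨by simpa [branch] using hy0, by simpa [branch] using hy1⟩]
      simp [branch, hτ0.ne']
    · rw [h2 _ hx ⟨by simp only [branch, cond_true]; linarith,
        by simp only [branch, cond_true]; linarith⟩]
      ext
      · simp only [branch, cond_true]; ring
      · simp only [branch, cond_true]; field_simp; ring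
  have hs₁ := simDim_nonneg hK.pos (hK.lt_half.trans (by norm_num))
  have hs₂ := simDim_nonneg hL.pos (hL.lt_half.trans (by norm_num))
  have hs := add_nonneg hs₁ hs₂
  have hsum : 2 * Real.log 2 / Real.log (1 / β) + 2 * Real.log 2 / Real.log τ =
      simDim β + simDim (1 / τ) + (simDim β + simDim (1 / τ)) := by
    simp only [simDim, one_div_one_div]; ring
  have hbox := hK.hasBoxCover.prod hs₁ hs₂ hL.hasBoxCover
  have hbox2 := hbox.prod hs hs hbox
  rw [← Real.coe_toNNReal _ (add_nonneg hs hs)] at hbox2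
  have hup := hbox2.dimH_le
  have hlow := hh.le_dimH_liYorkePairs hK hL
  have hmono : dimH (liYorkePairs h (Λ₁ ×ˢ Λ₂)) ≤ dimH ((Λ₁ ×ˢ Λ₂) ×ˢ (Λ₁ ×ˢ Λ₂)) :=
    dimH_mono fun p hp => ⟨hp.1, hp.2.1⟩
  rw [hsum]
  exact ⟨hh.image_prod hK hL, le_antisymm hmono (hup.trans hlow),
    le_antisymm hup (hlow.trans hmono)⟩

end
end
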